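/- arXiv:1204.1317 — 3 statements merged into one kernel-verified Lean document; each statement's English description precedes it below -/
import Mathlib

section
/- Assume additionally r > 0, q ≥ 0 and β ≥ 1. Let f : O → ℝ be continuous and obey the elliptic growth condition, and let g : Γ₁ → ℝ be continuous and obey the elliptic growth condition. If u₁ and u₂ are both continuous on O ∪ Γ₁, twice continuously differentiable on O, obey the elliptic growth condition on O, and satisfy A uᵢ = f on O and uᵢ = g on Γ₁ (i = 1, 2), then u₁ = u₂ on O ∪ Γ₁. -/
open Real Set MeasureTheory

noncomputable section

/-- First directional derivative of `u` at `z` in direction `v`. -/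
def D1 (u : ℝ × ℝ → ℝ) (z v : ℝ × ℝ) : ℝ := fderiv ℝ u z v

/-- Second directional derivative of `u` at `z` in directions `v`, `w`. -/
def D2 (u : ℝ × ℝ → ℝ) (z v w : ℝ × ℝ) : ℝ := fderiv ℝ (fun z' => fderiv ℝ u z' v) z w

/-- The elliptic Heston operator
`(Au)(x,y) = −(y/2)(u_xx + 2ρσ u_xy + σ² u_yy) − (r − q − y/2) u_x − κ(θ − y) u_y + r u`. -/
def hestonA (σ ρ κ θ q r : ℝ) (u : ℝ × ℝ → ℝ) (z : ℝ × ℝ) : ℝ :=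
  -(z.2 / 2) * (D2 u z (1, 0) (1, 0) + 2 * ρ * σ * D2 u z (1, 0) (0, 1)
      + σ ^ 2 * D2 u z (0, 1) (0, 1))
    - (r - q - z.2 / 2) * D1 u z (1, 0) - κ * (θ - z.2) * D1 u z (0, 1) + r * u z

/-- The open upper half-plane `ℍ = ℝ × (0,∞)`. -/
def HH : Set (ℝ × ℝ) := {z | 0 < z.2}

/-- `Γ₁ = ∂O ∩ ℍ`. -/
def Gamma1 (O : Set (ℝ × ℝ)) : Set (ℝ × ℝ) := frontier O ∩ HH

/-- `Γ₀`: the interior, relative to `∂ℍ = ℝ × {0}`, of `∂ℍ ∩ ∂O`. -/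
def Gamma0 (O : Set (ℝ × ℝ)) : Set (ℝ × ℝ) :=
  {z | z.2 = 0 ∧ z.1 ∈ interior {x : ℝ | (x, (0 : ℝ)) ∈ frontier O}}

/-- The elliptic growth condition: `|v(x,y)| ≤ C (1 + e^{M₁ y} + e^{M₂ x})` on `S`,
with `0 ≤ M₁ < min (r/(κθ)) μ`, `μ = 2κ/σ²`, and `M₂ ∈ [0,1)`. -/
def ellGrowth (σ κ θ r : ℝ) (S : Set (ℝ × ℝ)) (v : ℝ × ℝ → ℝ) : Prop :=
  ∃ C M₁ M₂ : ℝ, 0 < C ∧ 0 ≤ M₁ ∧ M₁ < min (r / (κ * θ)) (2 * κ / σ ^ 2) ∧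
    0 ≤ M₂ ∧ M₂ < 1 ∧ ∀ z ∈ S, |v z| ≤ C * (1 + exp (M₁ * z.2) + exp (M₂ * z.1))

lemma D1_eventually_line (v : ℝ × ℝ → ℝ) (z w : ℝ × ℝ) (hv : ContDiffAt ℝ 2 v z) :
    ∀ᶠ z' in nhds z, DifferentiableAt ℝ v z' := by
  have h := hv.eventually (by simp)
  filter_upwards [h] with z' hz'
  exact hz'.differentiableAt (by simp)

lemma D1_diff (v : ℝ × ℝ → ℝ) (z w : ℝ × ℝ) (hv : ContDiffAt ℝ 2 v z) :
    DifferentiableAt ℝ (fun z' => fderiv ℝ v z' w) z := by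
  have h : ContDiffAt ℝ 1 (fderiv ℝ v) z := hv.fderiv_right (by norm_num)
  have h2 : DifferentiableAt ℝ (fderiv ℝ v) z := h.differentiableAt (by simp)
  exact h2.clm_apply (differentiableAt_const w)

lemma D2_eq (v : ℝ × ℝ → ℝ) (z w w' : ℝ × ℝ) (hv : ContDiffAt ℝ 2 v z) :
    D2 v z w w' = fderiv ℝ (fderiv ℝ v) z w' w := by
  have h : ContDiffAt ℝ 1 (fderiv ℝ v) z := hv.fderiv_right (by norm_num)
  have h2 : DifferentiableAt ℝ (fderiv ℝ v) z := h.differentiableAt (by simp)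
  have := (h2.hasFDerivAt.clm_apply (hasFDerivAt_const w z)).fderiv
  unfold D2
  rw [this]
  simp

lemma D2_nonpos (v : ℝ × ℝ → ℝ) (z w : ℝ × ℝ) (hv : ContDiffAt ℝ 2 v z)
    (hm : IsLocalMax v z) : D2 v z w w ≤ 0 := by
  by_contra hpos
  push Not at hpos
  have hl : ∀ t : ℝ, HasDerivAt (fun t : ℝ => z + t • w) w t := fun t => by
    simpa using ((hasDerivAt_id t).smul_const w).const_add z
  have hlt : Filter.Tendsto (fun t : ℝ => z + t • w) (nhds 0) (nhds z) := by
    have := (hl 0).continuousAt.tendsto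
    simpa using this
  have hd : ∀ᶠ t in nhds (0 : ℝ),
      deriv (fun t : ℝ => v (z + t • w)) t = fderiv ℝ v (z + t • w) w := by
    filter_upwards [hlt.eventually (D1_eventually_line v z w hv)] with t ht
    exact (ht.hasFDerivAt.comp_hasDerivAt t (hl t)).deriv
  have hdd : deriv (deriv (fun t : ℝ => v (z + t • w))) 0 = D2 v z w w := by
    rw [Filter.EventuallyEq.deriv_eq (show deriv (fun t : ℝ => v (z + t • w)) =ᶠ[nhds 0]
      (fun t => fderiv ℝ v (z + t • w) w) from hd)]
    have h1 : HasFDerivAt (fun z' => fderiv ℝ v z' w)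
        (fderiv ℝ (fun z' => fderiv ℝ v z' w) z) (z + (0:ℝ) • w) := by
      simpa using (D1_diff v z w hv).hasFDerivAt
    exact (h1.comp_hasDerivAt (0:ℝ) (hl 0)).deriv
  have hmax : IsLocalMax (fun t : ℝ => v (z + t • w)) 0 := by
    have := hlt.eventually hm
    filter_upwards [this] with t ht
    simpa using ht
  have hmin : IsLocalMin (fun t : ℝ => v (z + t • w)) 0 := by
    apply isLocalMin_of_deriv_deriv_pos
    · rw [hdd]; exact hpos
    · exact hmax.deriv_eq_zero
    · have : ContinuousAt v (z + (0:ℝ) • w) := by simpa using hv.continuousAt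
      exact ContinuousAt.comp (g := v) this (hl 0).continuousAt
  have hconst : (fun t : ℝ => v (z + t • w)) =ᶠ[nhds 0] fun _ => v z := by
    filter_upwards [hmax, hmin] with t h1 h2
    simp at h1 h2
    exact le_antisymm h1 h2
  have h0 : deriv (deriv (fun t : ℝ => v (z + t • w))) 0 = 0 := by
    rw [hconst.deriv.deriv_eq]
    simp
  rw [hdd] at h0
  linarith

lemma heston_at_max (σ ρ κ θ q r : ℝ) (hρ₁ : -1 < ρ) (hρ₂ : ρ < 1)
    (v : ℝ × ℝ → ℝ) (z : ℝ × ℝ) (hz : 0 < z.2) (hv : ContDiffAt ℝ 2 v z)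
    (hm : IsLocalMax v z) : r * v z ≤ hestonA σ ρ κ θ q r v z := by
  have h1 : ∀ w, D1 v z w = 0 := fun w => by
    unfold D1; rw [hm.fderiv_eq_zero]; simp
  have h2 := D2_nonpos v z (1, ρ * σ) hv hm
  have h3 := D2_nonpos v z (0, 1) hv hm
  have hsymm : D2 v z (0, 1) (1, 0) = D2 v z (1, 0) (0, 1) := by
    rw [D2_eq _ _ _ _ hv, D2_eq _ _ _ _ hv]
    exact hv.isSymmSndFDerivAt (by simp) _ _
  have hexp : D2 v z (1, ρ * σ) (1, ρ * σ) = D2 v z (1, 0) (1, 0)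
      + 2 * ρ * σ * D2 v z (1, 0) (0, 1) + (ρ * σ) ^ 2 * D2 v z (0, 1) (0, 1) := by
    have hw : ((1, ρ * σ) : ℝ × ℝ) = (1, 0) + (ρ * σ) • (0, 1) := by ext <;> simp
    have e : D2 v z (1, ρ * σ) (1, ρ * σ) = D2 v z (1, 0) (1, 0)
      + ρ * σ * D2 v z (1, 0) (0, 1) + ρ * σ * D2 v z (0, 1) (1, 0)
      + (ρ * σ) ^ 2 * D2 v z (0, 1) (0, 1) := by
      simp only [D2_eq _ _ _ _ hv]
      rw [hw]
      simp only [map_add, map_smul, ContinuousLinearMap.add_apply, ContinuousLinearMap.smul_apply,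
        smul_eq_mul]
      ring
    rw [e, hsymm]; ring
  rw [hexp] at h2
  unfold hestonA
  rw [h1, h1]
  have h4 : D2 v z (1, 0) (1, 0) + 2 * ρ * σ * D2 v z (1, 0) (0, 1)
      + σ ^ 2 * D2 v z (0, 1) (0, 1) ≤ 0 := by
    have : 0 ≤ σ ^ 2 * (1 - ρ ^ 2) := mul_nonneg (sq_nonneg _) (by nlinarith)
    nlinarith [mul_nonneg this (neg_nonneg.2 h3)]
  nlinarith [mul_nonneg hz.le (neg_nonneg.2 h4)]

lemma hestonA_lin (σ ρ κ θ q r ε : ℝ) (u₁ u₂ W : ℝ × ℝ → ℝ) (z : ℝ × ℝ)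
    (h₁ : ContDiffAt ℝ 2 u₁ z) (h₂ : ContDiffAt ℝ 2 u₂ z) (hW : ContDiffAt ℝ 2 W z) :
    hestonA σ ρ κ θ q r (fun z => u₁ z - u₂ z - ε * W z) z =
      hestonA σ ρ κ θ q r u₁ z - hestonA σ ρ κ θ q r u₂ z - ε * hestonA σ ρ κ θ q r W z := by
  have key : ∀ z', DifferentiableAt ℝ u₁ z' → DifferentiableAt ℝ u₂ z' → DifferentiableAt ℝ W z' →
      ∀ w, fderiv ℝ (fun z => u₁ z - u₂ z - ε * W z) z' w =
        fderiv ℝ u₁ z' w - fderiv ℝ u₂ z' w - ε * fderiv ℝ W z' w := by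
    intro z' a b c w
    have h : HasFDerivAt (fun z => u₁ z - u₂ z - ε * W z) _ z' :=
      (a.hasFDerivAt.sub b.hasFDerivAt).sub (c.hasFDerivAt.const_mul ε)
    rw [h.fderiv]
    simp
  have e1 : ∀ w, D1 (fun z => u₁ z - u₂ z - ε * W z) z w =
      D1 u₁ z w - D1 u₂ z w - ε * D1 W z w := fun w =>
    key z (h₁.differentiableAt (by simp)) (h₂.differentiableAt (by simp))
      (hW.differentiableAt (by simp)) w
  have e2 : ∀ w w', D2 (fun z => u₁ z - u₂ z - ε * W z) z w w' =
      D2 u₁ z w w' - D2 u₂ z w w' - ε * D2 W z w w' := by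
    intro w w'
    unfold D2
    have : (fun z' => fderiv ℝ (fun z => u₁ z - u₂ z - ε * W z) z' w) =ᶠ[nhds z]
        fun z' => fderiv ℝ u₁ z' w - fderiv ℝ u₂ z' w - ε * fderiv ℝ W z' w := by
      filter_upwards [D1_eventually_line u₁ z w h₁, D1_eventually_line u₂ z w h₂,
        D1_eventually_line W z w hW] with z' a b c
      exact key z' a b c w
    have h : HasFDerivAt
        (fun z' => fderiv ℝ u₁ z' w - fderiv ℝ u₂ z' w - ε * fderiv ℝ W z' w) _ z :=
      ((D1_diff u₁ z w h₁).hasFDerivAt.sub (D1_diff u₂ z w h₂).hasFDerivAt).sub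
        ((D1_diff W z w hW).hasFDerivAt.const_mul ε)
    rw [this.fderiv_eq, h.fderiv]
    simp
  unfold hestonA
  simp only [e1, e2]
  ring

lemma hestonA_sep (σ ρ κ θ q r : ℝ) (a a1 a2 b b1 b2 : ℝ → ℝ)
    (ha : ∀ x, HasDerivAt a (a1 x) x) (ha1 : ∀ x, HasDerivAt a1 (a2 x) x)
    (hb : ∀ y, 0 < y → HasDerivAt b (b1 y) y) (hb1 : ∀ y, 0 < y → HasDerivAt b1 (b2 y) y)
    (z : ℝ × ℝ) (hz : 0 < z.2) :
    hestonA σ ρ κ θ q r (fun z => a z.1 + b z.2) z =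
      -(z.2 / 2) * (a2 z.1 + σ ^ 2 * b2 z.2) - (r - q - z.2 / 2) * a1 z.1
      - κ * (θ - z.2) * b1 z.2 + r * (a z.1 + b z.2) := by
  have key : ∀ (a a1 b b1 : ℝ → ℝ), (∀ x, HasDerivAt a (a1 x) x) →
      (∀ y, 0 < y → HasDerivAt b (b1 y) y) → ∀ z : ℝ × ℝ, 0 < z.2 → ∀ w,
      fderiv ℝ (fun z : ℝ × ℝ => a z.1 + b z.2) z w = a1 z.1 * w.1 + b1 z.2 * w.2 := by
    intro a a1 b b1 ha hb z hz w
    have h1 : HasFDerivAt (fun z : ℝ × ℝ => a z.1) (a1 z.1 • ContinuousLinearMap.fst ℝ ℝ ℝ) z :=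
      (ha z.1).comp_hasFDerivAt z (hasFDerivAt_fst (𝕜 := ℝ) (E := ℝ) (F := ℝ))
    have h2 : HasFDerivAt (fun z : ℝ × ℝ => b z.2) (b1 z.2 • ContinuousLinearMap.snd ℝ ℝ ℝ) z :=
      (hb z.2 hz).comp_hasFDerivAt z (hasFDerivAt_snd (𝕜 := ℝ) (E := ℝ) (F := ℝ))
    have h : HasFDerivAt (fun z : ℝ × ℝ => a z.1 + b z.2) _ z := h1.add h2
    rw [h.fderiv]
    simp
  have ev : ∀ᶠ z' : ℝ × ℝ in nhds z, 0 < z'.2 :=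
    (isOpen_lt continuous_const continuous_snd).mem_nhds hz
  have e2 : ∀ w w', D2 (fun z : ℝ × ℝ => a z.1 + b z.2) z w w' =
      a2 z.1 * w.1 * w'.1 + b2 z.2 * w.2 * w'.2 := by
    intro w w'
    unfold D2
    have : (fun z' => fderiv ℝ (fun z : ℝ × ℝ => a z.1 + b z.2) z' w) =ᶠ[nhds z]
        fun z' => (fun x => a1 x * w.1) z'.1 + (fun y => b1 y * w.2) z'.2 := by
      filter_upwards [ev] with z' hz'
      exact key a a1 b b1 ha hb z' hz' w
    rw [this.fderiv_eq, key (fun x => a1 x * w.1) (fun x => a2 x * w.1) (fun y => b1 y * w.2)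
      (fun y => b2 y * w.2) (fun x => (ha1 x).mul_const _) (fun y hy => (hb1 y hy).mul_const _) z hz]
  unfold hestonA D1
  simp only [e2, key a a1 b b1 ha hb z hz]
  ring

/-- The barrier function. -/
def barW (K0 K1 M α : ℝ) (z : ℝ × ℝ) : ℝ :=
  (√(1 + z.1 ^ 2) + exp (α * z.1)) + (K0 + K1 * exp (M * z.2) - log z.2)

lemma barW_contDiffAt (K0 K1 M α : ℝ) (z : ℝ × ℝ) (hz : 0 < z.2) :
    ContDiffAt ℝ 2 (barW K0 K1 M α) z := by
  unfold barW
  have h1 : (1 + z.1 ^ 2) ≠ 0 := by positivity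
  have h2 : z.2 ≠ 0 := hz.ne'
  fun_prop (disch := assumption)

lemma barW_super (σ ρ κ θ q r K0 K1 M α : ℝ) (hσ : σ ≠ 0) (hκ : 0 < κ) (hr : 0 < r)
    (hq : 0 ≤ q) (hβ : σ ^ 2 ≤ 2 * κ * θ) (hα0 : 0 < α) (hα1 : α < 1) (hM0 : 0 < M)
    (hMμ : σ ^ 2 * M < 2 * κ) (hMr : κ * θ * M < r)
    (hK0 : |r - q| + κ ≤ r * K0) (hK1p : 0 < K1) (hK1 : 1 + r ≤ K1 * (r - κ * θ * M) * M)
    (z : ℝ × ℝ) (hz : 0 < z.2) : 0 ≤ hestonA σ ρ κ θ q r (barW K0 K1 M α) z := by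
  have hs0 : ∀ x : ℝ, 0 < √(1 + x ^ 2) := fun x => by positivity
  have hsq : ∀ x : ℝ, √(1 + x ^ 2) ^ 2 = 1 + x ^ 2 := fun x => sq_sqrt (by positivity)
  have hsd : ∀ x : ℝ, HasDerivAt (fun x => √(1 + x ^ 2)) (x / √(1 + x ^ 2)) x := fun x => by
    have h : HasDerivAt (fun x : ℝ => 1 + x ^ 2) (2 * x) x := by
      simpa using (hasDerivAt_pow 2 x).const_add 1
    convert h.sqrt (by positivity) using 1
    have := hs0 x
    field_simp
  have hed : ∀ c x : ℝ, HasDerivAt (fun x => exp (c * x)) (c * exp (c * x)) x := fun c x => by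
    have h : HasDerivAt (fun x : ℝ => c * x) c x := by
      simpa using (hasDerivAt_id x).const_mul c
    simpa [mul_comm] using h.exp
  have H := hestonA_sep σ ρ κ θ q r (fun x => √(1 + x ^ 2) + exp (α * x))
    (fun x => x / √(1 + x ^ 2) + α * exp (α * x))
    (fun x => (1 * √(1 + x ^ 2) - x * (x / √(1 + x ^ 2))) / √(1 + x ^ 2) ^ 2
      + α * (α * exp (α * x)))
    (fun y => K0 + K1 * exp (M * y) - log y)
    (fun y => K1 * (M * exp (M * y)) - y⁻¹)
    (fun y => K1 * (M * (M * exp (M * y))) - (-(y ^ 2)⁻¹))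
    (fun x => (hsd x).add (hed α x))
    (fun x => ((hasDerivAt_id x).div (hsd x) (hs0 x).ne').add ((hed α x).const_mul α))
    (fun y hy => (((hed M y).const_mul K1).const_add K0).sub (hasDerivAt_log hy.ne'))
    (fun y hy => (((hed M y).const_mul M).const_mul K1).sub (hasDerivAt_inv hy.ne'))
    z hz
  change 0 ≤ hestonA σ ρ κ θ q r (fun z => (√(1 + z.1 ^ 2) + exp (α * z.1))
    + (K0 + K1 * exp (M * z.2) - log z.2)) z
  rw [H]
  obtain ⟨x, y⟩ := z
  simp only at hz ⊢
  have hl : log y ≤ y := (log_le_sub_one_of_pos hz).trans (by linarith)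
  have hs := hs0 x
  have hsx := hsq x
  have hs1 : 1 ≤ √(1 + x ^ 2) := by
    rw [Real.one_le_sqrt]; nlinarith [sq_nonneg x]
  set s := √(1 + x ^ 2) with hsdef
  have hp : |x / s| ≤ 1 := by
    rw [abs_div, abs_of_pos hs, div_le_one hs]
    apply abs_le_of_sq_le_sq _ hs.le
    linarith
  have hp2 : (1 * s - x * (x / s)) / s ^ 2 ≤ 1 := by
    have : (1 * s - x * (x / s)) / s ^ 2 = 1 / s ^ 3 := by
      field_simp
      linarith
    rw [this, div_le_one (by positivity)]
    exact one_le_pow₀ hs1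
  set p := x / s
  set p2 := (1 * s - x * p) / s ^ 2
  have hp' := abs_le.1 hp
  have E1 : 0 < exp (α * x) := exp_pos _
  have E2 : M * y + 1 ≤ exp (M * y) := add_one_le_exp _
  have E2' : 0 < exp (M * y) := exp_pos _
  set X := exp (α * x)
  set Y := exp (M * y)
  have T1 : -y - |r - q| ≤ -(y / 2) * p2 - (r - q - y / 2) * p + r * s := by
    have a1 : (r - q) * p ≤ |r - q| := by
      calc (r - q) * p ≤ |(r - q) * p| := le_abs_self _
        _ = |r - q| * |p| := abs_mul _ _
        _ ≤ |r - q| * 1 := by gcongr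
        _ = _ := mul_one _
    have a2 : (y / 2) * p2 ≤ y / 2 := by nlinarith
    have a3 : -(y / 2) ≤ (y / 2) * p := by nlinarith
    have a4 : 0 < r * s := by positivity
    linarith
  have T2 : 0 ≤ -(y / 2) * (α * (α * X)) - (r - q - y / 2) * (α * X) + r * X := by
    have : -(y / 2) * (α * (α * X)) - (r - q - y / 2) * (α * X) + r * X
      = X * ((y / 2) * α * (1 - α) + r * (1 - α) + q * α) := by ring
    rw [this]
    have : 0 < 1 - α := by linarith
    positivity
  have T3 : (1 + r) * y ≤ -(y / 2) * (σ ^ 2 * (K1 * (M * (M * Y)))) - κ * (θ - y) * (K1 * (M * Y))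
      + r * (K1 * Y) := by
    have e : -(y / 2) * (σ ^ 2 * (K1 * (M * (M * Y)))) - κ * (θ - y) * (K1 * (M * Y))
      + r * (K1 * Y) = K1 * Y * M * y * (κ - σ ^ 2 * M / 2) + K1 * (r - κ * θ * M) * Y := by ring
    rw [e]
    have a1 : 0 ≤ K1 * Y * M * y * (κ - σ ^ 2 * M / 2) := by
      have : 0 ≤ κ - σ ^ 2 * M / 2 := by linarith
      positivity
    have a2 : (1 + r) * y ≤ K1 * (r - κ * θ * M) * M * y := by gcongr
    have a3 : K1 * (r - κ * θ * M) * (M * y) ≤ K1 * (r - κ * θ * M) * Y := by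
      have : 0 < r - κ * θ * M := by linarith
      gcongr
      linarith
    linarith
  have T4 : -κ - r * y ≤ -(y / 2) * (σ ^ 2 * (y ^ 2)⁻¹) + κ * (θ - y) * y⁻¹ - r * log y := by
    have e : -(y / 2) * (σ ^ 2 * (y ^ 2)⁻¹) + κ * (θ - y) * y⁻¹ =
        (2 * κ * θ - σ ^ 2) / (2 * y) - κ := by
      field_simp
      ring
    rw [e]
    have : 0 ≤ (2 * κ * θ - σ ^ 2) / (2 * y) := div_nonneg (by linarith) (by linarith)
    nlinarith
  linarith

lemma exp_absorb (C η m M : ℝ) (hC : 0 < C) (hη : 0 < η) (hm : 0 ≤ m) (hM : m < M) :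
    ∃ D, 0 ≤ D ∧ ∀ y : ℝ, C * exp (m * y) ≤ η * exp (M * y) + D := by
  refine ⟨C * exp (m * (log (C / η) / (M - m))), by positivity, fun y => ?_⟩
  have hd : 0 < M - m := by linarith
  rcases le_total (log (C / η) / (M - m)) y with h | h
  · rw [div_le_iff₀ hd, log_le_iff_le_exp (by positivity), div_le_iff₀ hη] at h
    have : exp (M * y) = exp (m * y) * exp (y * (M - m)) := by rw [← exp_add]; ring_nf
    rw [this]
    have h0 : 0 ≤ C * exp (m * (log (C / η) / (M - m))) := by positivity
    nlinarith [exp_pos (m * y)]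
  · have : C * exp (m * y) ≤ C * exp (m * (log (C / η) / (M - m))) := by gcongr
    have : 0 < η * exp (M * y) := by positivity
    linarith

set_option maxHeartbeats 1000000 in
lemma heston_le (σ ρ κ θ q r : ℝ) (hσ : σ ≠ 0) (hρ₁ : -1 < ρ) (hρ₂ : ρ < 1)
    (hκ : 0 < κ) (hθ : 0 < θ) (hr : 0 < r) (hq : 0 ≤ q)
    (hβ : 1 ≤ 2 * κ * θ / σ ^ 2)
    (O : Set (ℝ × ℝ)) (hO : IsOpen O) (hOsub : O ⊆ HH)
    (u₁ u₂ : ℝ × ℝ → ℝ)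
    (hu₁c : ContinuousOn u₁ (O ∪ Gamma1 O)) (hu₁d : ContDiffOn ℝ 2 u₁ O)
    (hu₁g : ellGrowth σ κ θ r O u₁)
    (hu₂c : ContinuousOn u₂ (O ∪ Gamma1 O)) (hu₂d : ContDiffOn ℝ 2 u₂ O)
    (hu₂g : ellGrowth σ κ θ r O u₂)
    (heq : ∀ z ∈ O, hestonA σ ρ κ θ q r u₁ z = hestonA σ ρ κ θ q r u₂ z)
    (hb : ∀ z ∈ Gamma1 O, u₁ z = u₂ z) : ∀ z ∈ O, u₁ z ≤ u₂ z := by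
  intro z₀ hz₀
  by_contra hlt
  push Not at hlt
  obtain ⟨C, m, n, hC, hm0, hm, hn0, hn, hg1⟩ := hu₁g
  obtain ⟨C', m', n', hC', hm0', hm', hn0', hn', hg2⟩ := hu₂g
  have hσ2 : 0 < σ ^ 2 := by positivity
  have hβ' : σ ^ 2 ≤ 2 * κ * θ := by rwa [one_le_div hσ2] at hβ
  obtain ⟨M, hM1, hM2⟩ := exists_between (max_lt hm hm')
  obtain ⟨α, hα1, hα2⟩ := exists_between (max_lt hn hn')
  obtain ⟨hmM, hmM'⟩ := max_lt_iff.1 hM1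
  obtain ⟨hnα, hnα'⟩ := max_lt_iff.1 hα1
  obtain ⟨hMr, hMμ⟩ := lt_min_iff.1 hM2
  have hM0 : 0 < M := by linarith
  have hα0 : 0 < α := by linarith
  rw [lt_div_iff₀ (by positivity)] at hMr hMμ
  have hc0 : 0 < r - κ * θ * M := by nlinarith
  obtain ⟨K0, hK0⟩ : ∃ K0, K0 = (|r - q| + κ) / r := ⟨_, rfl⟩
  have hK0p : 0 < K0 := by rw [hK0]; positivity
  have hK0e : |r - q| + κ ≤ r * K0 := by rw [hK0]; field_simp; exact le_rfl
  obtain ⟨K1, hK1⟩ : ∃ K1, K1 = (1 + r) / ((r - κ * θ * M) * M) + 4 / M + 1 := ⟨_, rfl⟩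
  have hA : 0 < (1 + r) / ((r - κ * θ * M) * M) := by positivity
  have hB : 0 < 4 / M := by positivity
  have hK1p : 1 < K1 := by linarith
  have hK1a : 1 + r ≤ K1 * (r - κ * θ * M) * M := by
    rw [mul_assoc, ← div_le_iff₀ (by positivity)]; linarith
  have hK1b : 4 ≤ K1 * M := by rw [← div_le_iff₀ hM0]; linarith
  set W := barW K0 K1 M α with hW
  have hWlow : ∀ z : ℝ × ℝ, 0 < z.2 → √(1 + z.1 ^ 2) + exp (α * z.1) + K0
      + K1 / 2 * exp (M * z.2) + 2 * z.2 - log z.2 ≤ W z := by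
    intro z hz
    have E2 : M * z.2 + 1 ≤ exp (M * z.2) := add_one_le_exp _
    have : 2 * z.2 ≤ K1 / 2 * exp (M * z.2) := by
      have : K1 / 2 * (M * z.2) ≤ K1 / 2 * exp (M * z.2) := by gcongr; linarith
      nlinarith
    simp only [hW, barW]
    linarith
  have hlog : ∀ y : ℝ, 0 < y → log y ≤ y := fun y hy =>
    (log_le_sub_one_of_pos hy).trans (by linarith)
  have hWpos : ∀ z : ℝ × ℝ, 0 < z.2 → 0 < W z := by
    intro z hz
    have := hWlow z hz
    have := hlog _ hz
    have : 0 < K1 / 2 * exp (M * z.2) := by positivity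
    have : 0 ≤ √(1 + z.1 ^ 2) := sqrt_nonneg _
    have := exp_pos (α * z.1)
    linarith
  have hW0 := hWpos z₀ (hOsub hz₀)
  obtain ⟨ε, hε⟩ : ∃ ε, ε = (u₁ z₀ - u₂ z₀) / (2 * W z₀) := ⟨_, rfl⟩
  have hε0 : 0 < ε := by rw [hε]; apply div_pos <;> linarith
  have hv0 : 0 < u₁ z₀ - u₂ z₀ - ε * W z₀ := by
    have : ε * W z₀ = (u₁ z₀ - u₂ z₀) / 2 := by rw [hε]; field_simp
    linarith
  obtain ⟨D1', hD1, hd1⟩ := exp_absorb C (ε / 4) m M hC (by positivity) hm0 hmM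
  obtain ⟨D2', hD2, hd2⟩ := exp_absorb C' (ε / 4) m' M hC' (by positivity) hm0' hmM'
  obtain ⟨D3', hD3, hd3⟩ := exp_absorb C (ε / 4) n α hC (by positivity) hn0 hnα
  obtain ⟨D4', hD4, hd4⟩ := exp_absorb C' (ε / 4) n' α hC' (by positivity) hn0' hnα'
  obtain ⟨D, hD⟩ : ∃ D, D = C + C' + D1' + D2' + D3' + D4' := ⟨_, rfl⟩
  have hDp : 0 < D := by linarith
  obtain ⟨T, hT⟩ : ∃ T, T = D / ε := ⟨_, rfl⟩
  have hTD : ε * T = D := by rw [hT]; field_simp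
  have hTp : 0 < T := by rw [hT]; positivity
  have hbound : ∀ z ∈ O, 0 < u₁ z - u₂ z - ε * W z →
      √(1 + z.1 ^ 2) + 2 * z.2 - log z.2 < T := by
    intro z hz hv
    have hzp : 0 < z.2 := hOsub hz
    have a1 := (abs_le.1 (hg1 z hz)).2
    have a2 := (abs_le.1 (hg2 z hz)).1
    have b1 := hd1 z.2
    have b2 := hd2 z.2
    have b3 := hd3 z.1
    have b4 := hd4 z.1
    have c1 := mul_le_mul_of_nonneg_left (hWlow z hzp) hε0.le
    have c2 : 0 < ε * K0 := by positivity
    have c3 : ε / 2 * exp (M * z.2) ≤ ε * (K1 / 2 * exp (M * z.2)) := by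
      have := exp_pos (M * z.2)
      have : 0 ≤ ε * exp (M * z.2) * (K1 - 1) := mul_nonneg (by positivity) (by linarith)
      linarith
    have c4 : 0 < ε * exp (α * z.1) := by positivity
    have : ε * (√(1 + z.1 ^ 2) + 2 * z.2 - log z.2) < ε * T := by
      rw [hTD, hD]
      linarith
    exact lt_of_mul_lt_mul_left this hε0.le
  set B : Set (ℝ × ℝ) := Icc (-T) T ×ˢ Icc (exp (-T)) T with hBdef
  have hBsub : ∀ z ∈ O, 0 < u₁ z - u₂ z - ε * W z → z ∈ B := by
    intro z hz hv
    have h := hbound z hz hv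
    have hzp : 0 < z.2 := hOsub hz
    have hl := hlog _ hzp
    have hx : |z.1| ≤ √(1 + z.1 ^ 2) := by
      apply abs_le_sqrt; linarith
    have hx0 := abs_nonneg z.1
    have hx' : |z.1| ≤ T := by linarith
    refine ⟨abs_le.1 hx', ?_, by linarith⟩
    rw [← le_log_iff_exp_le hzp]
    linarith
  have hBH : ∀ z ∈ B, 0 < z.2 := fun z hz => lt_of_lt_of_le (exp_pos _) hz.2.1
  have hKsub : closure O ∩ B ⊆ O ∪ Gamma1 O := by
    rintro z ⟨hz, hzB⟩
    by_cases hzO : z ∈ O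
    · exact Or.inl hzO
    · right
      refine ⟨?_, hBH z hzB⟩
      rw [hO.frontier_eq]
      exact ⟨hz, hzO⟩
  have hKc : IsCompact (closure O ∩ B) :=
    (isCompact_Icc.prod isCompact_Icc).inter_left isClosed_closure
  have hvc : ContinuousOn (fun z => u₁ z - u₂ z - ε * W z) (closure O ∩ B) := by
    refine ((hu₁c.mono hKsub).sub (hu₂c.mono hKsub)).sub (continuousOn_const.mul ?_)
    intro z hz
    exact (barW_contDiffAt K0 K1 M α z (hBH z hz.2)).continuousAt.continuousWithinAt
  have hz₀K : z₀ ∈ closure O ∩ B := ⟨subset_closure hz₀, hBsub z₀ hz₀ hv0⟩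
  obtain ⟨z, hzK, hzmax⟩ := hKc.exists_isMaxOn ⟨z₀, hz₀K⟩ hvc
  have hvz : 0 < u₁ z - u₂ z - ε * W z := lt_of_lt_of_le hv0 (hzmax hz₀K)
  have hzp := hBH z hzK.2
  have hzO : z ∈ O := by
    rcases hKsub hzK with h | h
    · exact h
    · exfalso
      have := hb z h
      have := mul_pos hε0 (hWpos z hzp)
      linarith
  have hlm : IsLocalMax (fun z => u₁ z - u₂ z - ε * W z) z := by
    filter_upwards [hO.mem_nhds hzO] with z' hz'
    by_cases h : 0 < u₁ z' - u₂ z' - ε * W z'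
    · exact hzmax ⟨subset_closure hz', hBsub z' hz' h⟩
    · linarith
  have d1 := hu₁d.contDiffAt (hO.mem_nhds hzO)
  have d2 := hu₂d.contDiffAt (hO.mem_nhds hzO)
  have d3 := barW_contDiffAt K0 K1 M α z hzp
  have hmx := heston_at_max σ ρ κ θ q r hρ₁ hρ₂ _ z hzp
    ((d1.sub d2).sub (contDiffAt_const (c := ε) |>.mul d3)) hlm
  have hlin := hestonA_lin σ ρ κ θ q r ε u₁ u₂ W z d1 d2 d3
  have hsup := barW_super σ ρ κ θ q r K0 K1 M α hσ hκ hr hq hβ' hα0 hα2 hM0 (by linarith)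
    (by linarith) hK0e (by linarith) hK1a z hzp
  have e := heq z hzO
  have p1 := mul_pos hr hvz
  have p2 := mul_nonneg hε0.le hsup
  have hmx' : r * (u₁ z - u₂ z - ε * W z) ≤
      hestonA σ ρ κ θ q r (fun z => u₁ z - u₂ z - ε * W z) z := hmx
  rw [hlin, e] at hmx'
  linarith

/-- Uniqueness of solutions to the elliptic Heston boundary value problem when `β ≥ 1`. -/
theorem heston_elliptic_bvp_uniqueness_beta_ge_one
    (σ ρ κ θ q r : ℝ) (hσ : σ ≠ 0) (hρ₁ : -1 < ρ) (hρ₂ : ρ < 1)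
    (hκ : 0 < κ) (hθ : 0 < θ) (hr : 0 < r) (hq : 0 ≤ q)
    (hβ : 1 ≤ 2 * κ * θ / σ ^ 2)
    (O : Set (ℝ × ℝ)) (hO : IsOpen O) (hOconn : IsConnected O) (hOsub : O ⊆ HH)
    (hΓ₀ : (Gamma0 O).Nonempty)
    (f g u₁ u₂ : ℝ × ℝ → ℝ)
    (hf : ContinuousOn f O) (hfg : ellGrowth σ κ θ r O f)
    (hg : ContinuousOn g (Gamma1 O)) (hgg : ellGrowth σ κ θ r (Gamma1 O) g)
    (hu₁c : ContinuousOn u₁ (O ∪ Gamma1 O)) (hu₁d : ContDiffOn ℝ 2 u₁ O)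
    (hu₁g : ellGrowth σ κ θ r O u₁)
    (hu₁eq : ∀ z ∈ O, hestonA σ ρ κ θ q r u₁ z = f z)
    (hu₁b : ∀ z ∈ Gamma1 O, u₁ z = g z)
    (hu₂c : ContinuousOn u₂ (O ∪ Gamma1 O)) (hu₂d : ContDiffOn ℝ 2 u₂ O)
    (hu₂g : ellGrowth σ κ θ r O u₂)
    (hu₂eq : ∀ z ∈ O, hestonA σ ρ κ θ q r u₂ z = f z)
    (hu₂b : ∀ z ∈ Gamma1 O, u₂ z = g z) :
    EqOn u₁ u₂ (O ∪ Gamma1 O) := by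
  intro z hz
  rcases hz with hz | hz
  · exact le_antisymm
      (heston_le σ ρ κ θ q r hσ hρ₁ hρ₂ hκ hθ hr hq hβ O hO hOsub u₁ u₂ hu₁c hu₁d hu₁g hu₂c hu₂d hu₂g
        (fun z hz => (hu₁eq z hz).trans (hu₂eq z hz).symm)
        (fun z hz => (hu₁b z hz).trans (hu₂b z hz).symm) z hz)
      (heston_le σ ρ κ θ q r hσ hρ₁ hρ₂ hκ hθ hr hq hβ O hO hOsub u₂ u₁ hu₂c hu₂d hu₂g hu₁c hu₁d hu₁g
        (fun z hz => (hu₂eq z hz).trans (hu₁eq z hz).symm)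
        (fun z hz => (hu₂b z hz).trans (hu₁b z hz).symm) z hz)
  · exact (hu₁b z hz).trans (hu₂b z hz).symm

end
end

section
/- Assume β ≥ 1. Let f : Q → ℝ be continuous and obey the parabolic growth condition, and let g : ∂¹Q → ℝ be continuous and obey the parabolic growth condition. If u₁ and u₂ are both continuous on Q ∪ ∂¹Q, belong to C²(Q), obey the parabolic growth condition on Q, and satisfy −∂_t uᵢ + A uᵢ = f on Q and uᵢ = g on ∂¹Q (i = 1, 2), then u₁ = u₂ on Q ∪ ∂¹Q. -/
open Real Set MeasureTheory

noncomputable section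

/-- Time derivative `u_t` at `p = (t, z)`. -/
def Dt (u : ℝ × (ℝ × ℝ) → ℝ) (p : ℝ × (ℝ × ℝ)) : ℝ := deriv (fun s => u (s, p.2)) p.1

/-- The Heston operator acting in the spatial variables for each fixed time. -/
def hestonP (σ ρ κ θ q r : ℝ) (u : ℝ × (ℝ × ℝ) → ℝ) (p : ℝ × (ℝ × ℝ)) : ℝ :=
  hestonA σ ρ κ θ q r (fun z => u (p.1, z)) p.2

/-- The parabolic cylinder `Q = (0,T) × O`. -/
def parQ (T : ℝ) (O : Set (ℝ × ℝ)) : Set (ℝ × (ℝ × ℝ)) := Ioo (0 : ℝ) T ×ˢ O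

/-- The partial parabolic boundary `∂¹Q = (0,T) × Γ₁ ∪ {T} × (O ∪ Γ₁)`. -/
def parB1 (T : ℝ) (O : Set (ℝ × ℝ)) : Set (ℝ × (ℝ × ℝ)) :=
  Ioo (0 : ℝ) T ×ˢ Gamma1 O ∪ ({T} : Set ℝ) ×ˢ (O ∪ Gamma1 O)

/-- The full parabolic boundary `∂Q = (0,T) × ∂O ∪ {T} × cl(O)`. -/
def parB (T : ℝ) (O : Set (ℝ × ℝ)) : Set (ℝ × (ℝ × ℝ)) :=
  Ioo (0 : ℝ) T ×ˢ frontier O ∪ ({T} : Set ℝ) ×ˢ closure O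

/-- The parabolic growth condition: `|v(t,x,y)| ≤ C (1 + e^{M₁ y} + e^{M₂ x})` on `S`,
with `0 ≤ M₁ < μ = 2κ/σ²` and `M₂ ∈ [0,1]`. -/
def parabGrowth (σ κ : ℝ) (S : Set (ℝ × (ℝ × ℝ))) (v : ℝ × (ℝ × ℝ) → ℝ) : Prop :=
  ∃ C M₁ M₂ : ℝ, 0 < C ∧ 0 ≤ M₁ ∧ M₁ < 2 * κ / σ ^ 2 ∧ 0 ≤ M₂ ∧ M₂ ≤ 1 ∧
    ∀ p ∈ S, |v p| ≤ C * (1 + exp (M₁ * p.2.2) + exp (M₂ * p.2.1))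

/-- `u ∈ C²(Q)`: the time derivative `u_t` and the spatial derivatives `Du`, `D²u` exist
and are continuous on `Q`. -/
def C2Parab (Q : Set (ℝ × (ℝ × ℝ))) (u : ℝ × (ℝ × ℝ) → ℝ) : Prop :=
  (∀ p ∈ Q, DifferentiableAt ℝ (fun s => u (s, p.2)) p.1) ∧
  ContinuousOn (fun p => Dt u p) Q ∧
  (∀ p ∈ Q, DifferentiableAt ℝ (fun z => u (p.1, z)) p.2) ∧
  ContinuousOn (fun p => fderiv ℝ (fun z => u (p.1, z)) p.2) Q ∧
  (∀ p ∈ Q, DifferentiableAt ℝ (fun z => fderiv ℝ (fun z' => u (p.1, z')) z) p.2) ∧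
  ContinuousOn (fun p => fderiv ℝ (fun z => fderiv ℝ (fun z' => u (p.1, z')) z) p.2) Q


theorem sndTest (h h' : ℝ → ℝ) (c : ℝ) (hd : ∀ᶠ s in nhds (0:ℝ), HasDerivAt h (h' s) s)
    (hd2 : HasDerivAt h' c 0) (hm : IsLocalMax h 0) : h' 0 = 0 ∧ c ≤ 0 := by
  have h0 : h' 0 = 0 := hm.hasDerivAt_eq_zero hd.self_of_nhds
  refine ⟨h0, ?_⟩
  by_contra hc
  push Not at hc
  have e1 : deriv h =ᶠ[nhds 0] h' := hd.mono fun s hs => hs.deriv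
  have e2 : deriv (deriv h) 0 = c := by rw [e1.deriv_eq, hd2.deriv]
  have hmin := isLocalMin_of_deriv_deriv_pos (f := h) (x₀ := 0) (by rw [e2]; exact hc)
    (by rw [e1.self_of_nhds, h0]) hd.self_of_nhds.continuousAt
  have e3 : h =ᶠ[nhds 0] fun _ => h 0 := by
    filter_upwards [hm, hmin] with s h1 h2
    exact le_antisymm h1 h2
  have e4 : deriv h =ᶠ[nhds 0] fun _ => 0 := by
    have := e3.deriv
    simpa using this
  have : deriv (deriv h) 0 = 0 := by rw [e4.deriv_eq]; simp
  linarith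


theorem lineFacts (u : ℝ × ℝ → ℝ) (O : Set (ℝ × ℝ)) (hO : IsOpen O)
    (h1 : ∀ z ∈ O, DifferentiableAt ℝ u z) (h2 : ∀ z ∈ O, DifferentiableAt ℝ (fun z => fderiv ℝ u z) z)
    (z : ℝ × ℝ) (hz : z ∈ O) (a b : ℝ) :
    ∃ p' : ℝ → ℝ, (∀ᶠ s in nhds (0:ℝ), HasDerivAt (fun s => u (z.1 + s * a, z.2 + s * b)) (p' s) s) ∧
      p' 0 = a * D1 u z (1, 0) + b * D1 u z (0, 1) ∧
      HasDerivAt p' (a ^ 2 * D2 u z (1, 0) (1, 0) + 2 * a * b * D2 u z (1, 0) (0, 1)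
        + b ^ 2 * D2 u z (0, 1) (0, 1)) 0 := by
  have hl : ∀ s : ℝ, HasDerivAt (fun s : ℝ => (z.1 + s * a, z.2 + s * b)) (a, b) s := by
    intro s
    have h1 : HasDerivAt (fun s : ℝ => z.1 + s * a) a s := by
      simpa using ((hasDerivAt_id s).mul_const a).const_add z.1
    have h2 : HasDerivAt (fun s : ℝ => z.2 + s * b) b s := by
      simpa using ((hasDerivAt_id s).mul_const b).const_add z.2
    exact h1.prodMk h2
  have hz0 : (z.1 + 0 * a, z.2 + 0 * b) = z := by simp
  have hev : ∀ᶠ s in nhds (0:ℝ), (z.1 + s * a, z.2 + s * b) ∈ O := by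
    apply (hl 0).continuousAt.eventually_mem
    rw [hz0]; exact hO.mem_nhds hz
  have hab : ((a, b) : ℝ × ℝ) = a • ((1, 0) : ℝ × ℝ) + b • ((0, 1) : ℝ × ℝ) := by simp
  refine ⟨fun s => fderiv ℝ u (z.1 + s * a, z.2 + s * b) (a, b), ?_, ?_, ?_⟩
  · filter_upwards [hev] with s hs
    exact (h1 _ hs).hasFDerivAt.comp_hasDerivAt s (hl s)
  · simp only [hz0, D1]
    rw [hab, map_add, map_smul, map_smul]; simp
  · have hsym : ∀ v w, fderiv ℝ (fun z => fderiv ℝ u z) z v w = fderiv ℝ (fun z => fderiv ℝ u z) z w v := by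
      apply second_derivative_symmetric_of_eventually (f := u) (f' := fun z => fderiv ℝ u z) (x := z)
      · filter_upwards [hO.mem_nhds hz] with y hy
        exact (h1 y hy).hasFDerivAt
      · exact (h2 z hz).hasFDerivAt
    have hD2 : ∀ v w, D2 u z v w = fderiv ℝ (fun z => fderiv ℝ u z) z w v := by
      intro v w
      unfold D2
      have := (h2 z hz).hasFDerivAt.clm_apply (hasFDerivAt_const v z)
      rw [this.fderiv]; simp
    have h3 : HasDerivAt (fun s : ℝ => fderiv ℝ u (z.1 + s * a, z.2 + s * b))
        (fderiv ℝ (fun z => fderiv ℝ u z) z (a, b)) 0 := by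
      have h4 := (h2 z hz).hasFDerivAt
      rw [← hz0] at h4
      have := h4.comp_hasDerivAt (0:ℝ) (hl 0)
      rw [hz0] at this
      exact this
    have h5 := h3.clm_apply (hasDerivAt_const (0:ℝ) ((a, b) : ℝ × ℝ))
    refine h5.congr_deriv ?_
    simp only [hD2]
    rw [hab]
    simp only [map_add, map_smul, _root_.add_apply, _root_.smul_apply, smul_eq_mul, map_zero, add_zero]
    rw [hsym (1,0) (0,1)]
    ring

/-- spatial barrier -/
def barr (A M a c b : ℝ) (z : ℝ × ℝ) : ℝ :=
  -Real.log z.2 + A * Real.exp (M * z.2) + Real.exp (a * z.1 + b * z.2)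
    + Real.exp (c * z.1 + b * z.2)


theorem barrLine (A M a c b x y ξ η : ℝ) (hy : 0 < y) :
    ∃ p' : ℝ → ℝ, (∀ᶠ s in nhds (0:ℝ), HasDerivAt (fun s => barr A M a c b (x + s * ξ, y + s * η)) (p' s) s) ∧
      p' 0 = -(η / y) + A * (M * η) * Real.exp (M * y) + (a * ξ + b * η) * Real.exp (a * x + b * y)
        + (c * ξ + b * η) * Real.exp (c * x + b * y) ∧
      HasDerivAt p' (η ^ 2 / y ^ 2 + A * (M * η) ^ 2 * Real.exp (M * y)
        + (a * ξ + b * η) ^ 2 * Real.exp (a * x + b * y)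
        + (c * ξ + b * η) ^ 2 * Real.exp (c * x + b * y)) 0 := by
  have h1 : ∀ s : ℝ, HasDerivAt (fun s : ℝ => x + s * ξ) ξ s := fun s => by
    simpa using ((hasDerivAt_id s).mul_const ξ).const_add x
  have h2 : ∀ s : ℝ, HasDerivAt (fun s : ℝ => y + s * η) η s := fun s => by
    simpa using ((hasDerivAt_id s).mul_const η).const_add y
  have hE : ∀ a s : ℝ, HasDerivAt (fun s : ℝ => Real.exp (a * (x + s * ξ) + b * (y + s * η)))
      ((a * ξ + b * η) * Real.exp (a * (x + s * ξ) + b * (y + s * η))) s := fun a s => by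
    have := (((h1 s).const_mul a).add ((h2 s).const_mul b)).exp
    rw [mul_comm] at this
    exact this
  have hF : ∀ s : ℝ, HasDerivAt (fun s : ℝ => Real.exp (M * (y + s * η)))
      ((M * η) * Real.exp (M * (y + s * η))) s := fun s => by
    have := ((h2 s).const_mul M).exp
    rw [mul_comm] at this
    exact this
  have hev : ∀ᶠ s in nhds (0:ℝ), 0 < y + s * η := by
    apply (h2 0).continuousAt.eventually (p := fun y => 0 < y)
    simp only [zero_mul, add_zero]
    exact lt_mem_nhds hy
  refine ⟨fun s => -(η / (y + s * η)) + A * ((M * η) * Real.exp (M * (y + s * η))) +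
    (a * ξ + b * η) * Real.exp (a * (x + s * ξ) + b * (y + s * η))
        + (c * ξ + b * η) * Real.exp (c * (x + s * ξ) + b * (y + s * η)), ?_, ?_, ?_⟩
  · filter_upwards [hev] with s hs
    unfold barr
    exact ((((h2 s).log hs.ne').neg.add ((hF s).const_mul A)).add (hE a s)).add (hE c s)
  · simp; ring
  · have hne : y + 0 * η ≠ 0 := by simpa using hy.ne'
    have := ((((hasDerivAt_const (0:ℝ) η).div (h2 0) hne).neg.add
      ((((hF 0).const_mul (M * η))).const_mul A)).add ((hE a 0).const_mul (a * ξ + b * η))).add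
        ((hE c 0).const_mul (c * ξ + b * η))
    refine this.congr_deriv ?_
    simp
    ring


theorem expDom (a b D : ℝ) (ha : 0 ≤ a) (hab : a < b) (hD : 0 < D) :
    ∃ D₁ : ℝ, 0 ≤ D₁ ∧ ∀ s : ℝ, D * Real.exp (a * s) ≤ 1 / 2 * Real.exp (b * s) + D₁ := by
  refine ⟨D * Real.exp (a * (Real.log (2 * D) / (b - a))), by positivity, fun s => ?_⟩
  have hba : 0 < b - a := by linarith
  rcases le_total (Real.log (2 * D) / (b - a)) s with h | h
  · rw [div_le_iff₀ hba, Real.log_le_iff_le_exp (by positivity)] at h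
    have e : Real.exp (b * s) = Real.exp (s * (b - a)) * Real.exp (a * s) := by
      rw [← Real.exp_add]; ring_nf
    have : 0 ≤ D * Real.exp (a * (Real.log (2 * D) / (b - a))) := by positivity
    rw [e]
    nlinarith [Real.exp_pos (a * s)]
  · have : D * Real.exp (a * s) ≤ D * Real.exp (a * (Real.log (2 * D) / (b - a))) := by
      gcongr
    have := Real.exp_pos (b * s)
    linarith


theorem logPart (M y : ℝ) (hM : 0 < M) (hy : 0 < y) :
    0 ≤ -Real.log y + 1 / M * Real.exp (M * y) := by
  have h1 := Real.log_le_sub_one_of_pos hy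
  have h2 : y ≤ 1 / M * Real.exp (M * y) := by
    rw [one_div, inv_mul_eq_div, le_div_iff₀ hM]
    linarith [Real.add_one_le_exp (M * y)]
  linarith


theorem barr_lower (M a c b : ℝ) (z : ℝ × ℝ) (hM : 0 < M) (hy : 0 < z.2) :
    Real.exp (M * z.2) + Real.exp (a * z.1 + b * z.2) + Real.exp (c * z.1 + b * z.2)
      ≤ barr (1 + 1 / M) M a c b z := by
  have := logPart M z.2 hM hy
  unfold barr
  linarith

/-- coercivity -/

theorem barr_coercive (M M₁ δ D : ℝ) (hM₁ : 0 ≤ M₁) (hM : M₁ < M) (hδ : 0 < δ) (hD : 0 < D) :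
    ∃ R η : ℝ, 0 < η ∧ ∀ (b : ℝ), 0 ≤ b → ∀ z : ℝ × ℝ, 0 < z.2 →
      ¬ (η ≤ z.2 ∧ z.2 ≤ R ∧ -R ≤ z.1 ∧ z.1 ≤ R) →
      D * (1 + Real.exp (M₁ * z.2) + Real.exp z.1) < barr (1 + 1 / M) M (1 + δ) (-δ) b z := by
  have hMp : 0 < M := by linarith
  obtain ⟨D₁, hD₁, h1⟩ := expDom M₁ M D hM₁ hM hD
  obtain ⟨D₂, hD₂, h2⟩ := expDom 1 (1 + δ) D (by norm_num) (by linarith) hD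
  set N := D + D₁ + D₂ with hN
  have hNp : 0 < N := by positivity
  refine ⟨2 * N / M + 2 * N + N / δ, Real.exp (-N - 1), Real.exp_pos _, fun b hb z hz hbox => ?_⟩
  have k1 := h1 z.2
  have k2 := h2 z.1
  rw [one_mul] at k2
  have hl := logPart M z.2 hMp hz
  have e1 : Real.exp ((1 + δ) * z.1) ≤ Real.exp ((1 + δ) * z.1 + b * z.2) := by
    gcongr; nlinarith
  have e2 : Real.exp (-δ * z.1) ≤ Real.exp (-δ * z.1 + b * z.2) := by
    gcongr; nlinarith
  have p1 := Real.exp_pos (M * z.2)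
  have p2 := Real.exp_pos ((1 + δ) * z.1)
  have p3 := Real.exp_pos (-δ * z.1)
  have q1 : 0 < 2 * N / M := by positivity
  have q3 : 0 < N / δ := by positivity
  suffices H : N < -Real.log z.2 + 1 / M * Real.exp (M * z.2) + 1 / 2 * Real.exp (M * z.2)
      + 1 / 2 * Real.exp ((1 + δ) * z.1) + Real.exp (-δ * z.1) by
    unfold barr
    nlinarith
  by_cases c1 : Real.exp (-N - 1) ≤ z.2
  · by_cases c2 : z.2 ≤ 2 * N / M + 2 * N + N / δ
    · by_cases c3 : -(2 * N / M + 2 * N + N / δ) ≤ z.1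
      · have c4 : ¬ (z.1 ≤ 2 * N / M + 2 * N + N / δ) := fun h => hbox ⟨c1, c2, c3, h⟩
        have : 2 * N < z.1 := by linarith
        have := Real.add_one_le_exp ((1 + δ) * z.1)
        nlinarith
      · have : N / δ < -z.1 := by linarith
        rw [div_lt_iff₀ hδ] at this
        have := Real.add_one_le_exp (-δ * z.1)
        nlinarith
    · have : 2 * N / M < z.2 := by linarith
      rw [div_lt_iff₀ hMp] at this
      have := Real.add_one_le_exp (M * z.2)
      nlinarith
  · push Not at c1
    have := (Real.log_lt_iff_lt_exp hz).2 c1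
    have : 0 < 1 / M * Real.exp (M * z.2) := by positivity
    linarith

/-- barrier supersolution inequality; `E = exp(My)`, `P, N` the two exponentials -/

theorem superSol (σ ρ κ θ q r : ℝ) (hρ₁ : -1 < ρ) (hρ₂ : ρ < 1)
    (hκ : 0 < κ) (hθ : 0 < θ) (hβ : σ ^ 2 ≤ 2 * κ * θ) (M δ b y E P N φ : ℝ)
    (hM : 0 < M) (hMμ : σ ^ 2 * M ≤ 2 * κ) (hδ : 0 < δ) (hδ1 : δ ≤ 1) (hδb : δ * (1 + δ) ≤ b)
    (hb : 0 < b) (hb1 : b ≤ 1) (hy : 0 < y) (hE : 1 ≤ E) (hP : 0 < P) (hN : 0 < N)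
    (hφ : E + P + N ≤ φ) :
    (y / 2) * ((1 / y ^ 2) * σ ^ 2 + (1 + 1 / M) * (M * σ) ^ 2 * E
        + ((1 + δ) ^ 2 + 2 * ρ * σ * (1 + δ) * b + σ ^ 2 * b ^ 2) * P
        + ((-δ) ^ 2 + 2 * ρ * σ * (-δ) * b + σ ^ 2 * b ^ 2) * N)
      + (r - q - y / 2) * ((1 + δ) * P + (-δ) * N)
      + κ * (θ - y) * (-(1 / y) + (1 + 1 / M) * M * E + b * P + b * N)
      - (1 + 4 * |σ| + σ ^ 2) * b * y * (P + N)
      < (κ + κ * θ * M * (1 + 1 / M) + 2 * |r - q| + κ * θ + 1) * φ := by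
  have hlog : (y / 2) * ((1 / y ^ 2) * σ ^ 2) + κ * (θ - y) * (-(1 / y)) ≤ κ := by
    have : (y / 2) * ((1 / y ^ 2) * σ ^ 2) + κ * (θ - y) * (-(1 / y)) = κ + (σ ^ 2 - 2 * κ * θ) / (2 * y) := by
      field_simp; ring
    rw [this]
    have : (σ ^ 2 - 2 * κ * θ) / (2 * y) ≤ 0 := div_nonpos_of_nonpos_of_nonneg (by linarith) (by linarith)
    linarith
  have hexp : (y / 2) * ((1 + 1 / M) * (M * σ) ^ 2 * E) + κ * (θ - y) * ((1 + 1 / M) * M * E)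
      ≤ κ * θ * M * (1 + 1 / M) * E := by
    have : κ * θ * M * (1 + 1 / M) * E - ((y / 2) * ((1 + 1 / M) * (M * σ) ^ 2 * E) + κ * (θ - y) * ((1 + 1 / M) * M * E))
      = (y / 2) * (1 + 1 / M) * M * E * (2 * κ - σ ^ 2 * M) := by ring
    have : 0 ≤ (y / 2) * (1 + 1 / M) * M * E * (2 * κ - σ ^ 2 * M) := 
      mul_nonneg (by positivity) (by linarith)
    linarith
  have hρσ : |ρ * σ| ≤ |σ| := by
    rw [abs_mul]
    have : |ρ| ≤ 1 := abs_le.2 ⟨by linarith, by linarith⟩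
    nlinarith [abs_nonneg σ]
  have hgen : ∀ a : ℝ, a ^ 2 - a ≤ b → |a| ≤ 2 → ∀ P : ℝ, 0 < P →
      (y / 2) * ((a ^ 2 + 2 * ρ * σ * a * b + σ ^ 2 * b ^ 2) * P) + (r - q - y / 2) * (a * P)
      + κ * (θ - y) * (b * P) - (1 + 4 * |σ| + σ ^ 2) * b * y * P ≤ (2 * |r - q| + κ * θ) * P := by
    intro a ha ha2 P hP
    have h1 : ρ * σ * a ≤ 2 * |σ| := by
      calc ρ * σ * a ≤ |ρ * σ * a| := le_abs_self _
        _ = |ρ * σ| * |a| := abs_mul _ _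
        _ ≤ |σ| * 2 := by gcongr
        _ = _ := by ring
    have h2 : (r - q) * a ≤ 2 * |r - q| := by
      calc (r - q) * a ≤ |(r - q) * a| := le_abs_self _
        _ = |r - q| * |a| := abs_mul _ _
        _ ≤ |r - q| * 2 := by gcongr
        _ = _ := by ring
    have h3 : σ ^ 2 * b ^ 2 ≤ σ ^ 2 * b := by
      have : b ^ 2 ≤ b := by nlinarith
      gcongr
    have h4 : a ^ 2 - a + 2 * ρ * σ * a * b + σ ^ 2 * b ^ 2 - 2 * κ * b
        ≤ 2 * ((1 + 4 * |σ| + σ ^ 2) * b) := by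
      have h5 := mul_le_mul_of_nonneg_right h1 hb.le
      have h6 := mul_pos hκ hb
      have h7 := mul_nonneg (abs_nonneg σ) hb.le
      have h8 := mul_nonneg (sq_nonneg σ) hb.le
      linarith
    have h9 : κ * θ * b ≤ κ * θ := by
      have := mul_pos hκ hθ
      nlinarith
    have h10 := mul_le_mul_of_nonneg_left h4 (by positivity : 0 ≤ y / 2)
    have h11 : (y / 2) * ((a ^ 2 + 2 * ρ * σ * a * b + σ ^ 2 * b ^ 2)) + (r - q - y / 2) * a
      + κ * (θ - y) * b - (1 + 4 * |σ| + σ ^ 2) * b * y ≤ (2 * |r - q| + κ * θ) := by linarith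
    have h12 := mul_le_mul_of_nonneg_right h11 hP.le
    linarith
  have g1 := hgen (1 + δ) (by linarith) (abs_le.2 ⟨by linarith, by linarith⟩) P hP
  have g2 := hgen (-δ) (by linarith) (abs_le.2 ⟨by linarith, by linarith⟩) N hN
  set L1 := κ * θ * M * (1 + 1 / M) with hL1
  set L2 := 2 * |r - q| + κ * θ with hL2
  have hL1p : 0 < L1 := by positivity
  have hL2p : 0 < L2 := by positivity
  have hfin : κ + L1 * E + L2 * P + L2 * N < (κ + L1 + L2 + 1) * φ := by
    have : (κ + L1 + L2 + 1) * (E + P + N) ≤ (κ + L1 + L2 + 1) * φ := by gcongr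
    have i1 : κ ≤ κ * E := by nlinarith
    have := mul_pos hκ hP
    have := mul_pos hκ hN
    have := mul_pos hL1p hP
    have := mul_pos hL1p hN
    have : 0 < L2 * E := by positivity
    linarith
  have : (κ + L1 + L2 + 1) * φ = (κ + L1 + 2 * |r - q| + κ * θ + 1) * φ := by rw [hL2]; ring
  linarith

theorem mem_HH_closure (T : ℝ) (O : Set (ℝ × ℝ)) (hO : IsOpen O) (t : ℝ) (z : ℝ × ℝ)
    (ht : 0 < t) (htT : t ≤ T) (hz : z ∈ closure O) (hy : 0 < z.2) :
    (t, z) ∈ parQ T O ∪ parB1 T O := by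
  have hz2 : z ∈ O ∪ Gamma1 O := by
    by_cases h : z ∈ O
    · exact Or.inl h
    · refine Or.inr ⟨⟨hz, ?_⟩, hy⟩
      rwa [hO.interior_eq]
  rcases htT.lt_or_eq with h | h
  · rcases hz2 with h2 | h2
    · exact Or.inl ⟨⟨ht, h⟩, h2⟩
    · exact Or.inr (Or.inl ⟨⟨ht, h⟩, h2⟩)
  · exact Or.inr (Or.inr ⟨h, hz2⟩)

theorem barr_cont (A M a c L : ℝ) : ContinuousOn (fun p : ℝ × (ℝ × ℝ) =>
    barr A M a c (Real.exp (-L * p.1)) p.2) {p | 0 < p.2.2} := by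
  unfold barr
  have : ContinuousOn (fun p : ℝ × (ℝ × ℝ) => Real.log p.2.2) {p | 0 < p.2.2} := by
    apply ContinuousOn.log
    · fun_prop
    · intro p hp; exact ne_of_gt hp
  fun_prop

theorem growth_comb (σ κ : ℝ) (Q : Set (ℝ × (ℝ × ℝ))) (hQ : ∀ p ∈ Q, 0 < p.2.2)
    (u₁ u₂ : ℝ × (ℝ × ℝ) → ℝ)
    (h1 : parabGrowth σ κ Q u₁) (h2 : parabGrowth σ κ Q u₂) :
    ∃ C M : ℝ, 0 < C ∧ 0 ≤ M ∧ M < 2 * κ / σ ^ 2 ∧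
      ∀ p ∈ Q, u₁ p - u₂ p ≤ C * (1 + Real.exp (M * p.2.2) + Real.exp p.2.1) := by
  obtain ⟨C, M, N, hC, hM0, hM, hN0, hN, h⟩ := h1
  obtain ⟨C', M', N', hC', hM0', hM', hN0', hN', h'⟩ := h2
  refine ⟨2 * (C + C'), max M M', by positivity, le_max_of_le_left hM0, max_lt hM hM', fun p hp => ?_⟩
  have hx : ∀ N : ℝ, 0 ≤ N → N ≤ 1 → Real.exp (N * p.2.1) ≤ 1 + Real.exp p.2.1 := by
    intro N h0 h1
    rcases le_total 0 p.2.1 with hx | hx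
    · have : Real.exp (N * p.2.1) ≤ Real.exp p.2.1 := by gcongr; nlinarith
      linarith
    · have : Real.exp (N * p.2.1) ≤ 1 := Real.exp_le_one_iff.2 (by nlinarith)
      have := Real.exp_pos p.2.1
      linarith
  have hy := hQ p hp
  have hy1 : Real.exp (M * p.2.2) ≤ Real.exp (max M M' * p.2.2) := by
    gcongr; exact le_max_left _ _
  have hy2 : Real.exp (M' * p.2.2) ≤ Real.exp (max M M' * p.2.2) := by
    gcongr; exact le_max_right _ _
  have a1 := (le_abs_self _).trans (h p hp)
  have a2 := (neg_le_abs _).trans (h' p hp)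
  have x1 := hx N hN0 hN
  have x2 := hx N' hN0' hN'
  have p1 := Real.exp_pos (max M M' * p.2.2)
  have p2 := Real.exp_pos p.2.1
  have b1 : C * (1 + Real.exp (M * p.2.2) + Real.exp (N * p.2.1)) ≤
      C * (2 * (1 + Real.exp (max M M' * p.2.2) + Real.exp p.2.1)) :=
    mul_le_mul_of_nonneg_left (by linarith) hC.le
  have b2 : C' * (1 + Real.exp (M' * p.2.2) + Real.exp (N' * p.2.1)) ≤
      C' * (2 * (1 + Real.exp (max M M' * p.2.2) + Real.exp p.2.1)) :=
    mul_le_mul_of_nonneg_left (by linarith) hC'.le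
  linarith

theorem right_max (h : ℝ → ℝ) (d t₀ T : ℝ) (hT : t₀ < T) (hd : HasDerivAt h d t₀)
    (hm : ∀ s, t₀ ≤ s → s < T → h s ≤ h t₀) : d ≤ 0 := by
  have h1 := hd.hasDerivWithinAt (s := Ioi t₀)
  rw [hasDerivWithinAt_iff_tendsto_slope' (by simp)] at h1
  refine le_of_tendsto h1 ?_
  filter_upwards [Ioo_mem_nhdsGT hT] with s hs
  rw [slope_def_field]
  exact div_nonpos_of_nonpos_of_nonneg (by linarith [hm s hs.1.le hs.2]) (by linarith [hs.1])

set_option maxHeartbeats 2000000 in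
theorem oneSide
    (σ ρ κ θ q r : ℝ) (hσ : σ ≠ 0) (hρ₁ : -1 < ρ) (hρ₂ : ρ < 1)
    (hκ : 0 < κ) (hθ : 0 < θ)
    (hβ : 1 ≤ 2 * κ * θ / σ ^ 2)
    (O : Set (ℝ × ℝ)) (hO : IsOpen O) (hOsub : O ⊆ HH)
    (T : ℝ) (f u₁ u₂ : ℝ × (ℝ × ℝ) → ℝ)
    (hu₁c : ContinuousOn u₁ (parQ T O ∪ parB1 T O)) (hu₁d : C2Parab (parQ T O) u₁)
    (hu₁g : parabGrowth σ κ (parQ T O) u₁)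
    (hu₁eq : ∀ p ∈ parQ T O, -Dt u₁ p + hestonP σ ρ κ θ q r u₁ p = f p)
    (hu₂c : ContinuousOn u₂ (parQ T O ∪ parB1 T O)) (hu₂d : C2Parab (parQ T O) u₂)
    (hu₂g : parabGrowth σ κ (parQ T O) u₂)
    (hu₂eq : ∀ p ∈ parQ T O, -Dt u₂ p + hestonP σ ρ κ θ q r u₂ p = f p)
    (hb : ∀ p ∈ parB1 T O, u₁ p = u₂ p) :
    ∀ p ∈ parQ T O, u₁ p ≤ u₂ p := by
  intro p₀ hp₀
  by_contra hlt
  push Not at hlt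
  have hσ2 : 0 < σ ^ 2 := by positivity
  have hβ' : σ ^ 2 ≤ 2 * κ * θ := by rwa [le_div_iff₀ hσ2, one_mul] at hβ
  have hQpos : ∀ p ∈ parQ T O, 0 < p.2.2 := fun p hp => hOsub hp.2
  obtain ⟨C, M₁, hC, hM₁, hM₁μ, hgr⟩ := growth_comb σ κ _ hQpos u₁ u₂ hu₁g hu₂g
  obtain ⟨M, hM₁M, hMμ⟩ := exists_between hM₁μ
  have hM : 0 < M := by linarith
  have hMμ' : σ ^ 2 * M ≤ 2 * κ := by
    rw [lt_div_iff₀ hσ2] at hMμ; linarith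
  set L := 1 + 4 * |σ| + σ ^ 2 with hL
  have hLp : 0 < L := by positivity
  set δ := Real.exp (-L * T) / 2 with hδdef
  have hδ : 0 < δ := by positivity
  set Λ := κ + κ * θ * M * (1 + 1 / M) + 2 * |r - q| + κ * θ + 1 with hΛ
  have hΛp : 0 < Λ := by positivity
  obtain ⟨ht₀, htT₀⟩ := hp₀.1
  have hT : 0 < T := by linarith
  have hδ1 : δ ≤ 1 := by
    have : Real.exp (-L * T) ≤ 1 := Real.exp_le_one_iff.2 (by nlinarith)
    linarith
  set φ : ℝ × (ℝ × ℝ) → ℝ := fun p => barr (1 + 1 / M) M (1 + δ) (-δ) (Real.exp (-L * p.1)) p.2 with hφ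
  have hφlow : ∀ p : ℝ × (ℝ × ℝ), 0 < p.2.2 → Real.exp (M * p.2.2) +
      Real.exp ((1 + δ) * p.2.1 + Real.exp (-L * p.1) * p.2.2) +
      Real.exp (-δ * p.2.1 + Real.exp (-L * p.1) * p.2.2) ≤ φ p := fun p hp =>
    barr_lower M (1 + δ) (-δ) _ p.2 hM hp
  have hφpos : ∀ p : ℝ × (ℝ × ℝ), 0 < p.2.2 → 0 < φ p := fun p hp =>
    lt_of_lt_of_le (by positivity) (hφlow p hp)
  set W : ℝ × (ℝ × ℝ) → ℝ := fun p => Real.exp (-r * p.1) * (u₁ p - u₂ p) with hW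
  have hW0 : 0 < W p₀ := mul_pos (Real.exp_pos _) (by linarith)
  obtain ⟨ε, hε, hεW⟩ : ∃ ε : ℝ, 0 < ε ∧ ε * Real.exp (-Λ * p₀.1) * φ p₀ < W p₀ := by
    have h1 := hφpos p₀ (hQpos p₀ hp₀)
    have h2 := Real.exp_pos (-Λ * p₀.1)
    refine ⟨W p₀ / (2 * Real.exp (-Λ * p₀.1) * φ p₀), by positivity, ?_⟩
    have : W p₀ / (2 * Real.exp (-Λ * p₀.1) * φ p₀) * Real.exp (-Λ * p₀.1) * φ p₀ = W p₀ / 2 := by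
      field_simp
    rw [this]; linarith
  set v : ℝ × (ℝ × ℝ) → ℝ := fun p => W p - ε * Real.exp (-Λ * p.1) * φ p with hv
  have hv0 : 0 < v p₀ := by simp only [hv]; linarith
  set D := C * Real.exp (|r| * T) / (ε * Real.exp (-Λ * T)) with hDdef
  have hD : 0 < D := by positivity
  obtain ⟨R, η, hη, hbox⟩ := barr_coercive M M₁ δ D hM₁ hM₁M hδ hD
  have hout : ∀ p ∈ parQ T O, ¬ (η ≤ p.2.2 ∧ p.2.2 ≤ R ∧ -R ≤ p.2.1 ∧ p.2.1 ≤ R) → v p < 0 := by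
    intro p hp hnb
    have h1 : D * (1 + Real.exp (M₁ * p.2.2) + Real.exp p.2.1) < φ p :=
      hbox _ (Real.exp_pos _).le p.2 (hQpos p hp) hnb
    have h2 := hgr p hp
    obtain ⟨hp1, hp2⟩ := hp.1
    have h3 : Real.exp (-r * p.1) ≤ Real.exp (|r| * T) := by
      gcongr
      · exact neg_le_abs r
    have h4 : Real.exp (-Λ * T) ≤ Real.exp (-Λ * p.1) := by
      apply Real.exp_le_exp.2; nlinarith
    set S := 1 + Real.exp (M₁ * p.2.2) + Real.exp p.2.1 with hS
    have hSp : 0 < S := by positivity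
    have h5 : W p ≤ Real.exp (|r| * T) * (C * S) := by
      calc W p ≤ Real.exp (-r * p.1) * (C * S) := by
            simp only [hW]; gcongr
        _ ≤ _ := by gcongr
    have h6 : Real.exp (|r| * T) * (C * S) = ε * Real.exp (-Λ * T) * (D * S) := by
      rw [hDdef]; field_simp
    have h7 : ε * Real.exp (-Λ * T) * (D * S) < ε * Real.exp (-Λ * T) * φ p := by gcongr
    have h8 : ε * Real.exp (-Λ * T) * φ p ≤ ε * Real.exp (-Λ * p.1) * φ p := by
      have := hφpos p (hQpos p hp)
      gcongr
    simp only [hv]; linarith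
  set K : Set (ℝ × (ℝ × ℝ)) := Icc p₀.1 T ×ˢ (closure O ∩ (Icc (-R) R ×ˢ Icc η R)) with hK
  have hKc : IsCompact K :=
    isCompact_Icc.prod ((isCompact_Icc.prod isCompact_Icc).inter_left isClosed_closure)
  have hKy : ∀ p ∈ K, 0 < p.2.2 := fun p hp => lt_of_lt_of_le hη hp.2.2.2.1
  have hKsub : K ⊆ parQ T O ∪ parB1 T O := fun p hp =>
    mem_HH_closure T O hO p.1 p.2 (lt_of_lt_of_le ht₀ hp.1.1) hp.1.2 hp.2.1 (hKy p hp)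
  have hinK : ∀ p ∈ parQ T O, p₀.1 ≤ p.1 → 0 ≤ v p → p ∈ K := by
    intro p hp hpt hvp
    by_contra hpK
    have := hout p hp (fun hh => hpK ⟨⟨hpt, hp.1.2.le⟩, subset_closure hp.2, ⟨hh.2.2.1, hh.2.2.2⟩, hh.1, hh.2.1⟩)
    linarith
  have hvc : ContinuousOn v K := by
    have hφc : ContinuousOn φ K := (barr_cont _ _ _ _ _).mono hKy
    have h1 := hu₁c.mono hKsub
    have h2 := hu₂c.mono hKsub
    simp only [hv, hW]
    fun_prop
  have hp₀K := hinK p₀ hp₀ le_rfl hv0.le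
  obtain ⟨p, hpK, hpmax⟩ := hKc.exists_isMaxOn ⟨p₀, hp₀K⟩ hvc
  have hvp : 0 < v p := lt_of_lt_of_le hv0 (hpmax hp₀K)
  have hpQ : p ∈ parQ T O := by
    rcases hKsub hpK with h | h
    · exact h
    · exfalso
      have h1 : 0 < ε * Real.exp (-Λ * p.1) * φ p := by
        have := hφpos p (hKy p hpK)
        positivity
      have h2 : W p = 0 := by simp only [hW]; rw [hb p h]; simp
      simp only [hv] at hvp
      linarith
  have hmax : ∀ p' ∈ parQ T O, p₀.1 ≤ p'.1 → v p' ≤ v p := by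
    intro p' hp' ht'
    by_contra hcon
    push Not at hcon
    have := hpmax (hinK p' hp' ht' (by linarith))
    exact absurd this (not_le.2 hcon)
  have htK : p₀.1 ≤ p.1 := hpK.1.1
  clear_value D K
  obtain ⟨t, z⟩ := p
  obtain ⟨x, y⟩ := z
  replace htK : p₀.1 ≤ t := htK
  have htQ : 0 < t ∧ t < T := hpQ.1
  have hzO : (x, y) ∈ O := hpQ.2
  have hy : 0 < y := hOsub hzO
  set b := Real.exp (-L * t) with hbdef
  have hbp : 0 < b := Real.exp_pos _
  have hb1 : b ≤ 1 := Real.exp_le_one_iff.2 (by nlinarith [htQ.1])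
  have hδb : δ * (1 + δ) ≤ b := by
    have : Real.exp (-L * T) ≤ b := Real.exp_le_exp.2 (by nlinarith [htQ.2])
    nlinarith
  set G := ε * Real.exp (-Λ * t) with hG
  have hGp : 0 < G := by positivity
  set E := Real.exp (-r * t) with hE
  have hEp : 0 < E := Real.exp_pos _
  set P := Real.exp ((1 + δ) * x + b * y) with hP
  set N := Real.exp (-δ * x + b * y) with hN
  set X := Real.exp (M * y) with hX
  -- spatial derivatives
  have hopen : ∀ z' ∈ O, (t, z') ∈ parQ T O := fun z' hz' => ⟨htQ, hz'⟩
  have hsp : ∀ ξ η : ℝ,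
      E * ((ξ * D1 (fun z => u₁ (t, z)) (x, y) (1, 0) + η * D1 (fun z => u₁ (t, z)) (x, y) (0, 1))
        - (ξ * D1 (fun z => u₂ (t, z)) (x, y) (1, 0) + η * D1 (fun z => u₂ (t, z)) (x, y) (0, 1)))
        - G * (-(η / y) + (1 + 1 / M) * (M * η) * X + ((1 + δ) * ξ + b * η) * P
          + (-δ * ξ + b * η) * N) = 0 ∧
      E * ((ξ ^ 2 * D2 (fun z => u₁ (t, z)) (x, y) (1, 0) (1, 0)
          + 2 * ξ * η * D2 (fun z => u₁ (t, z)) (x, y) (1, 0) (0, 1)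
          + η ^ 2 * D2 (fun z => u₁ (t, z)) (x, y) (0, 1) (0, 1))
        - (ξ ^ 2 * D2 (fun z => u₂ (t, z)) (x, y) (1, 0) (1, 0)
          + 2 * ξ * η * D2 (fun z => u₂ (t, z)) (x, y) (1, 0) (0, 1)
          + η ^ 2 * D2 (fun z => u₂ (t, z)) (x, y) (0, 1) (0, 1)))
        - G * (η ^ 2 / y ^ 2 + (1 + 1 / M) * (M * η) ^ 2 * X
          + ((1 + δ) * ξ + b * η) ^ 2 * P + (-δ * ξ + b * η) ^ 2 * N) ≤ 0 := by
    intro ξ η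
    obtain ⟨f1, hf1, hf1', hf1''⟩ := lineFacts (fun z => u₁ (t, z)) O hO
      (fun z' hz' => hu₁d.2.2.1 _ (hopen z' hz')) (fun z' hz' => hu₁d.2.2.2.2.1 _ (hopen z' hz'))
      (x, y) hzO ξ η
    obtain ⟨f2, hf2, hf2', hf2''⟩ := lineFacts (fun z => u₂ (t, z)) O hO
      (fun z' hz' => hu₂d.2.2.1 _ (hopen z' hz')) (fun z' hz' => hu₂d.2.2.2.2.1 _ (hopen z' hz'))
      (x, y) hzO ξ η
    obtain ⟨f3, hf3, hf3', hf3''⟩ := barrLine (1 + 1 / M) M (1 + δ) (-δ) b x y ξ η hy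
    have hd2 := ((hf1''.sub hf2'').const_mul E).sub (hf3''.const_mul G)
    have hlm : IsLocalMax (fun s => v (t, (x + s * ξ, y + s * η))) 0 := by
      have hc : ContinuousAt (fun s : ℝ => (x + s * ξ, y + s * η)) 0 := by fun_prop
      have hev : ∀ᶠ s in nhds (0:ℝ), (x + s * ξ, y + s * η) ∈ O := by
        apply hc.eventually_mem
        simpa using hO.mem_nhds hzO
      filter_upwards [hev] with s hs
      have := hmax (t, (x + s * ξ, y + s * η)) (hopen _ hs) htK
      simpa using this
    have hd1 : ∀ᶠ s in nhds (0:ℝ), HasDerivAt (fun s => v (t, (x + s * ξ, y + s * η)))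
        (E * (f1 s - f2 s) - G * f3 s) s := by
      filter_upwards [hf1, hf2, hf3] with s k1 k2 k3
      exact ((k1.sub k2).const_mul E).sub (k3.const_mul G)
    obtain ⟨r1, r2⟩ := sndTest _ _ _ hd1 hd2 hlm
    rw [hf1', hf2', hf3'] at r1
    exact ⟨r1, r2⟩
  -- time derivative
  have htime : (-r * E) * (u₁ (t, (x, y)) - u₂ (t, (x, y))) + E * (Dt u₁ (t, (x, y)) - Dt u₂ (t, (x, y)))
      - ((-Λ * G) * φ (t, (x, y)) + G * (-L * b * y * P + (-L * b * y * N))) ≤ 0 := by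
    have k1 : HasDerivAt (fun s => u₁ (s, (x, y))) (Dt u₁ (t, (x, y))) t :=
      (hu₁d.1 _ hpQ).hasDerivAt
    have k2 : HasDerivAt (fun s => u₂ (s, (x, y))) (Dt u₂ (t, (x, y))) t :=
      (hu₂d.1 _ hpQ).hasDerivAt
    have ke : ∀ c : ℝ, HasDerivAt (fun s : ℝ => Real.exp (c * s)) (c * Real.exp (c * t)) t := by
      intro c
      have := ((hasDerivAt_id t).const_mul c).exp
      simpa [mul_comm] using this
    have kP : ∀ a : ℝ, HasDerivAt (fun s : ℝ => Real.exp (a * x + Real.exp (-L * s) * y))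
        (-L * b * y * Real.exp (a * x + b * y)) t := by
      intro a
      have := (((ke (-L)).mul_const y).const_add (a * x)).exp
      exact this.congr_deriv (mul_comm _ _)
    have kφ : HasDerivAt (fun s => φ (s, (x, y))) (-L * b * y * P + (-L * b * y * N)) t := by
      have := ((kP (1 + δ)).const_add (-Real.log y + (1 + 1 / M) * Real.exp (M * y))).add (kP (-δ))
      exact this
    have kW := (ke (-r)).mul (k1.sub k2)
    have kG := ((ke (-Λ)).const_mul ε).mul kφ
    have := right_max (fun s => v (s, (x, y))) _ t T htQ.2 (kW.sub kG) (by
      intro s hs hsT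
      exact hmax (s, (x, y)) ⟨⟨by linarith [htQ.1], hsT⟩, hzO⟩ (by simpa using htK.trans hs))
    refine le_trans (le_of_eq ?_) this
    simp only [hG, hE, Pi.sub_apply]
    ring
  have heq1 := hu₁eq _ hpQ
  have heq2 := hu₂eq _ hpQ
  have hss := superSol σ ρ κ θ q r hρ₁ hρ₂ hκ hθ hβ' M δ b y X P N (φ (t, (x, y))) hM hMμ' hδ hδ1 hδb hbp hb1
    hy (Real.one_le_exp (by positivity)) (Real.exp_pos _) (Real.exp_pos _) (hφlow (t, (x, y)) hy)
  rw [← hL, ← hΛ] at hss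
  have s1 := (hsp 1 0).1
  have s2 := (hsp 0 1).1
  have s3 := (hsp 1 (ρ * σ)).2
  have s4 := (hsp 0 1).2
  simp only [hestonP, hestonA] at heq1 heq2
  generalize D1 (fun z => u₁ (t, z)) (x, y) (1, 0) = a1 at *
  generalize D1 (fun z => u₁ (t, z)) (x, y) (0, 1) = a2 at *
  generalize D2 (fun z => u₁ (t, z)) (x, y) (1, 0) (1, 0) = a3 at *
  generalize D2 (fun z => u₁ (t, z)) (x, y) (1, 0) (0, 1) = a4 at *
  generalize D2 (fun z => u₁ (t, z)) (x, y) (0, 1) (0, 1) = a5 at *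
  generalize D1 (fun z => u₂ (t, z)) (x, y) (1, 0) = b1 at *
  generalize D1 (fun z => u₂ (t, z)) (x, y) (0, 1) = b2 at *
  generalize D2 (fun z => u₂ (t, z)) (x, y) (1, 0) (1, 0) = b3 at *
  generalize D2 (fun z => u₂ (t, z)) (x, y) (1, 0) (0, 1) = b4 at *
  generalize D2 (fun z => u₂ (t, z)) (x, y) (0, 1) (0, 1) = b5 at *
  generalize Dt u₁ (t, (x, y)) = d1 at *
  generalize Dt u₂ (t, (x, y)) = d2 at *
  have hρσ : 0 ≤ σ ^ 2 * (1 - ρ ^ 2) := by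
    apply mul_nonneg hσ2.le; nlinarith
  have s5 := mul_le_mul_of_nonneg_left s3 (by positivity : 0 ≤ y / 2)
  have s6 := mul_le_mul_of_nonneg_left (mul_le_mul_of_nonneg_left s4 hρσ) (by positivity : 0 ≤ y / 2)
  have hss' := mul_lt_mul_of_pos_left hss hGp
  have h1 : d1 - d2 = -(y / 2) * ((a3 - b3) + 2 * ρ * σ * (a4 - b4) + σ ^ 2 * (a5 - b5))
    - (r - q - y / 2) * (a1 - b1) - κ * (θ - y) * (a2 - b2)
    + r * (u₁ (t, (x, y)) - u₂ (t, (x, y))) := by linarith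
  rw [h1] at htime
  have hfin : (0 : ℝ) < 0 := by
    linear_combination hss' + htime + s5 + s6 + (r - q - y / 2) * s1 + κ * (θ - y) * s2
  exact lt_irrefl _ hfin

/-- Uniqueness of solutions to the parabolic Heston terminal/boundary value problem
when `β ≥ 1`. -/
theorem heston_parabolic_bvp_uniqueness_beta_ge_one
    (σ ρ κ θ q r : ℝ) (hσ : σ ≠ 0) (hρ₁ : -1 < ρ) (hρ₂ : ρ < 1)
    (hκ : 0 < κ) (hθ : 0 < θ)
    (hβ : 1 ≤ 2 * κ * θ / σ ^ 2)
    (O : Set (ℝ × ℝ)) (hO : IsOpen O) (hOconn : IsConnected O) (hOsub : O ⊆ HH)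
    (hΓ₀ : (Gamma0 O).Nonempty)
    (T : ℝ) (hT : 0 < T)
    (f g u₁ u₂ : ℝ × (ℝ × ℝ) → ℝ)
    (hf : ContinuousOn f (parQ T O)) (hfg : parabGrowth σ κ (parQ T O) f)
    (hg : ContinuousOn g (parB1 T O)) (hgg : parabGrowth σ κ (parB1 T O) g)
    (hu₁c : ContinuousOn u₁ (parQ T O ∪ parB1 T O)) (hu₁d : C2Parab (parQ T O) u₁)
    (hu₁g : parabGrowth σ κ (parQ T O) u₁)
    (hu₁eq : ∀ p ∈ parQ T O, -Dt u₁ p + hestonP σ ρ κ θ q r u₁ p = f p)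
    (hu₁b : ∀ p ∈ parB1 T O, u₁ p = g p)
    (hu₂c : ContinuousOn u₂ (parQ T O ∪ parB1 T O)) (hu₂d : C2Parab (parQ T O) u₂)
    (hu₂g : parabGrowth σ κ (parQ T O) u₂)
    (hu₂eq : ∀ p ∈ parQ T O, -Dt u₂ p + hestonP σ ρ κ θ q r u₂ p = f p)
    (hu₂b : ∀ p ∈ parB1 T O, u₂ p = g p) :
    EqOn u₁ u₂ (parQ T O ∪ parB1 T O) := by
  have h12 : ∀ p ∈ parB1 T O, u₁ p = u₂ p := fun p hp => (hu₁b p hp).trans (hu₂b p hp).symm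
  have l1 := oneSide σ ρ κ θ q r hσ hρ₁ hρ₂ hκ hθ hβ O hO hOsub T f u₁ u₂ hu₁c hu₁d hu₁g hu₁eq
    hu₂c hu₂d hu₂g hu₂eq h12
  have l2 := oneSide σ ρ κ θ q r hσ hρ₁ hρ₂ hκ hθ hβ O hO hOsub T f u₂ u₁ hu₂c hu₂d hu₂g hu₂eq
    hu₁c hu₁d hu₁g hu₁eq (fun p hp => (h12 p hp).symm)
  rintro p (hp | hp)
  · exact le_antisymm (l1 p hp) (l2 p hp)
  · exact h12 p hp

end
end

section
/- Assume 0 < β < 1. Let f : Q → ℝ be continuous and obey the parabolic growth condition, and let g : ∂Q → ℝ be continuous and obey the parabolic growth condition. If u₁ and u₂ are both continuous on Q ∪ ∂Q, belong to C²(Q), obey the parabolic growth condition on Q, and satisfy −∂_t uᵢ + A uᵢ = f on Q and uᵢ = g on ∂Q (i = 1, 2), then u₁ = u₂ on Q ∪ ∂Q. -/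
open Real Set MeasureTheory

noncomputable section

open Filter Topology in
lemma hst_snd_test (k k' : ℝ → ℝ) (c : ℝ) (h1 : ∀ᶠ s in 𝓝 (0:ℝ), HasDerivAt k (k' s) s)
    (h2 : HasDerivAt k' c 0) (hm : IsLocalMax k 0) : k' 0 = 0 ∧ c ≤ 0 := by
  have h0 : HasDerivAt k (k' 0) 0 := h1.self_of_nhds
  have hk0 : k' 0 = 0 := hm.hasDerivAt_eq_zero h0
  refine ⟨hk0, ?_⟩
  by_contra hc
  push Not at hc
  have hd : deriv k =ᶠ[𝓝 0] k' := h1.mono fun s hs => hs.deriv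
  have hdd : deriv (deriv k) 0 = c := by
    rw [hd.deriv_eq]; exact h2.deriv
  have hmin : IsLocalMin k 0 := by
    apply isLocalMin_of_deriv_deriv_pos
    · rw [hdd]; exact hc
    · rw [h0.deriv, hk0]
    · exact h0.continuousAt
  have hconst : k =ᶠ[𝓝 0] fun _ => k 0 := by
    filter_upwards [hm, hmin] with s a b
    exact le_antisymm a b
  have hd0 : deriv k =ᶠ[𝓝 0] fun _ => 0 := by
    have := hconst.deriv
    simpa using this
  have : deriv (deriv k) 0 = 0 := by rw [hd0.deriv_eq]; simp
  linarith

open Filter Topology in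
lemma hst_time_test (φ : ℝ → ℝ) (d t t1 : ℝ) (ht : t < t1) (h : HasDerivAt φ d t)
    (hm : ∀ s ∈ Icc t t1, φ s ≤ φ t) : d ≤ 0 := by
  have h' := hasDerivAt_iff_tendsto_slope.1 h
  have h'' : Tendsto (slope φ t) (𝓝[>] t) (𝓝 d) :=
    h'.mono_left (nhdsWithin_mono _ fun s hs => ne_of_gt hs)
  refine le_of_tendsto h'' ?_
  filter_upwards [Ioo_mem_nhdsGT ht] with s hs
  rw [slope_def_field]
  have := hm s ⟨hs.1.le, hs.2.le⟩
  exact div_nonpos_of_nonpos_of_nonneg (by linarith) (by linarith [hs.1])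

lemma hst_D2_eq (U : ℝ × ℝ → ℝ) (z : ℝ × ℝ)
    (h2 : DifferentiableAt ℝ (fun z => fderiv ℝ U z) z) (v w : ℝ × ℝ) :
    D2 U z v w = fderiv ℝ (fun z => fderiv ℝ U z) z w v := by
  unfold D2
  have := (h2.hasFDerivAt.clm_apply (hasFDerivAt_const v z)).fderiv
  rw [this]
  simp

lemma hst_D2_quad (U : ℝ × ℝ → ℝ) (O : Set (ℝ × ℝ)) (hO : IsOpen O) (z : ℝ × ℝ) (hz : z ∈ O)
    (h1 : ∀ z ∈ O, DifferentiableAt ℝ U z)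
    (h2 : DifferentiableAt ℝ (fun z => fderiv ℝ U z) z) (m : ℝ) :
    D2 U z (1, m) (1, m) = D2 U z (1, 0) (1, 0) + 2 * m * D2 U z (1, 0) (0, 1)
      + m ^ 2 * D2 U z (0, 1) (0, 1) := by
  have hsym := second_derivative_symmetric_of_eventually (f := U) (f' := fun z => fderiv ℝ U z)
    (f'' := fderiv ℝ (fun z => fderiv ℝ U z) z) (x := z)
    (by filter_upwards [hO.mem_nhds hz] with y hy using (h1 y hy).hasFDerivAt)
    h2.hasFDerivAt (1, 0) (0, 1)
  simp only [hst_D2_eq U z h2]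
  have e : ((1, m) : ℝ × ℝ) = (1, 0) + m • (0, 1) := by ext <;> simp
  rw [e]
  simp only [map_add, map_smul, add_apply, smul_apply,
    smul_eq_mul]
  rw [hsym]
  ring

open Filter Topology in
/-- The spatial information at a maximum along a line. -/
lemma hst_line (U : ℝ × ℝ → ℝ) (O : Set (ℝ × ℝ)) (hO : IsOpen O) (z : ℝ × ℝ) (hz : z ∈ O)
    (h1 : ∀ z ∈ O, DifferentiableAt ℝ U z)
    (h2 : DifferentiableAt ℝ (fun z => fderiv ℝ U z) z) (ε a b c : ℝ)
    (hm : ∀ z' ∈ O, U z' - ε * (exp (a * z'.1 + b * z'.2 + c) + exp (-a * z'.1 + b * z'.2 + c))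
      ≤ U z - ε * (exp (a * z.1 + b * z.2 + c) + exp (-a * z.1 + b * z.2 + c)))
    (v : ℝ × ℝ) :
    D1 U z v = ε * ((a * v.1 + b * v.2) * exp (a * z.1 + b * z.2 + c)
      + (-a * v.1 + b * v.2) * exp (-a * z.1 + b * z.2 + c)) ∧
    D2 U z v v ≤ ε * ((a * v.1 + b * v.2) ^ 2 * exp (a * z.1 + b * z.2 + c)
      + (-a * v.1 + b * v.2) ^ 2 * exp (-a * z.1 + b * z.2 + c)) := by
  have hl : ∀ s : ℝ, HasDerivAt (fun s : ℝ => z + s • v) v s := by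
    intro s
    simpa using ((hasDerivAt_id s).smul_const v).const_add z
  have hmem : ∀ᶠ s in 𝓝 (0:ℝ), z + s • v ∈ O := by
    have : ContinuousAt (fun s : ℝ => z + s • v) 0 := (hl 0).continuousAt
    apply this.preimage_mem_nhds
    simpa using hO.mem_nhds hz
  have hE : ∀ a' s : ℝ, HasDerivAt
      (fun s : ℝ => exp (a' * (z.1 + s * v.1) + b * (z.2 + s * v.2) + c))
      ((a' * v.1 + b * v.2) * exp (a' * (z.1 + s * v.1) + b * (z.2 + s * v.2) + c)) s := by
    intro a' s
    have i1 : HasDerivAt (fun s : ℝ => a' * (z.1 + s * v.1) + b * (z.2 + s * v.2) + c)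
        (a' * (1 * v.1) + b * (1 * v.2)) s :=
      (((((hasDerivAt_id s).mul_const v.1).const_add z.1).const_mul a').add
        ((((hasDerivAt_id s).mul_const v.2).const_add z.2).const_mul b)).add_const c
    convert i1.exp using 1
    ring
  have key := hst_snd_test
    (fun s => U (z + s • v) - ε * (exp (a * (z.1 + s * v.1) + b * (z.2 + s * v.2) + c)
      + exp (-a * (z.1 + s * v.1) + b * (z.2 + s * v.2) + c)))
    (fun s => fderiv ℝ U (z + s • v) v
      - ε * ((a * v.1 + b * v.2) * exp (a * (z.1 + s * v.1) + b * (z.2 + s * v.2) + c)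
      + (-a * v.1 + b * v.2) * exp (-a * (z.1 + s * v.1) + b * (z.2 + s * v.2) + c)))
    (D2 U z v v - ε * ((a * v.1 + b * v.2) * ((a * v.1 + b * v.2)
        * exp (a * (z.1 + 0 * v.1) + b * (z.2 + 0 * v.2) + c))
      + (-a * v.1 + b * v.2) * ((-a * v.1 + b * v.2)
        * exp (-a * (z.1 + 0 * v.1) + b * (z.2 + 0 * v.2) + c))))
    (by
      filter_upwards [hmem] with s hs
      exact ((h1 _ hs).hasFDerivAt.comp_hasDerivAt s (hl s)).sub
        (((hE a s).add (hE (-a) s)).const_mul ε))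
    (by
      refine HasDerivAt.sub ?_ ((((hE a 0).const_mul _).add ((hE (-a) 0).const_mul _)).const_mul ε)
      rw [hst_D2_eq U z h2]
      have h2' : HasFDerivAt (fun z => fderiv ℝ U z) (fderiv ℝ (fun z => fderiv ℝ U z) z)
          (z + (0:ℝ) • v) := by
        simpa using h2.hasFDerivAt
      have h3 : HasDerivAt (fun s : ℝ => fderiv ℝ U (z + s • v))
          (fderiv ℝ (fun z => fderiv ℝ U z) z v) 0 := h2'.comp_hasDerivAt (0:ℝ) (hl 0)
      simpa using h3.clm_apply (hasDerivAt_const (0:ℝ) v))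
    (by
      filter_upwards [hmem] with s hs
      have := hm _ hs
      simpa using this)
  obtain ⟨k1, k2⟩ := key
  simp only [zero_mul, add_zero, zero_smul] at k1 k2
  constructor
  · unfold D1; linarith
  · nlinarith

/-- The Heston operator at a spatial maximum of `U - ε Ψ`. -/
lemma hst_A_at_max (σ ρ κ θ q r : ℝ) (hρ₁ : -1 < ρ) (hρ₂ : ρ < 1)
    (U : ℝ × ℝ → ℝ) (O : Set (ℝ × ℝ)) (hO : IsOpen O) (z : ℝ × ℝ) (hz : z ∈ O)
    (hy : 0 < z.2)
    (h1 : ∀ z ∈ O, DifferentiableAt ℝ U z)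
    (h2 : DifferentiableAt ℝ (fun z => fderiv ℝ U z) z) (ε a b c : ℝ)
    (hm : ∀ z' ∈ O, U z' - ε * (exp (a * z'.1 + b * z'.2 + c) + exp (-a * z'.1 + b * z'.2 + c))
      ≤ U z - ε * (exp (a * z.1 + b * z.2 + c) + exp (-a * z.1 + b * z.2 + c))) :
    ε * (exp (a * z.1 + b * z.2 + c) * (-(z.2 / 2) * (a ^ 2 + 2 * ρ * σ * a * b + σ ^ 2 * b ^ 2)
        - (r - q - z.2 / 2) * a - κ * (θ - z.2) * b)
      + exp (-a * z.1 + b * z.2 + c) * (-(z.2 / 2) * (a ^ 2 - 2 * ρ * σ * a * b + σ ^ 2 * b ^ 2)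
        + (r - q - z.2 / 2) * a - κ * (θ - z.2) * b)) + r * U z
      ≤ hestonA σ ρ κ θ q r U z := by
  have L := hst_line U O hO z hz h1 h2 ε a b c hm
  have e1 := (L (1, 0)).1
  have e2 := (L (0, 1)).1
  have q1 := (L (1, ρ * σ)).2
  have q2 := (L (0, 1)).2
  rw [hst_D2_quad U O hO z hz h1 h2] at q1
  set E1 := exp (a * z.1 + b * z.2 + c)
  set E2 := exp (-a * z.1 + b * z.2 + c)
  unfold hestonA
  rw [e1, e2]
  simp only at q1 q2 ⊢
  have hp : 0 ≤ σ ^ 2 * (1 - ρ ^ 2) := by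
    apply mul_nonneg (sq_nonneg _); nlinarith
  have q3 := mul_le_mul_of_nonneg_left q2 hp
  have q4 := mul_le_mul_of_nonneg_left (add_le_add q1 q3) (by linarith : 0 ≤ z.2 / 2)
  nlinarith [q4]

lemma hst_bracket (σ ρ κ θ q r K L B a b y : ℝ) (hρ₁ : -1 < ρ) (hρ₂ : ρ < 1) (hκ : 0 < κ)
    (hθ : 0 < θ) (hB : 0 ≤ B) (hK : 3 + 2 * |σ| * B + σ ^ 2 * B ^ 2 / 2 ≤ K)
    (hL : 2 * |r - q| + κ * θ * B + |r| < L) (ha : |a| = 2) (hb0 : 0 ≤ b) (hb : b ≤ B)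
    (hy : 0 < y) :
    0 < -(y / 2) * (a ^ 2 + 2 * ρ * σ * a * b + σ ^ 2 * b ^ 2)
        - (r - q - y / 2) * a - κ * (θ - y) * b + K * y + L + r := by
  have ha2 : a ^ 2 = 4 := by rw [← sq_abs, ha]; norm_num
  have h1 : ρ * σ * a * b ≤ 2 * |σ| * B := by
    have hr : |ρ| ≤ 1 := abs_le.2 ⟨hρ₁.le, hρ₂.le⟩
    calc ρ * σ * a * b ≤ |ρ * σ * a * b| := le_abs_self _
      _ = |ρ| * |σ| * 2 * b := by rw [abs_mul, abs_mul, abs_mul, ha, abs_of_nonneg hb0]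
      _ ≤ 1 * |σ| * 2 * B := by gcongr
      _ = _ := by ring
  have h2 : σ ^ 2 * b ^ 2 ≤ σ ^ 2 * B ^ 2 := by gcongr
  have h3 : (r - q) * a ≤ 2 * |r - q| := by
    calc (r - q) * a ≤ |(r - q) * a| := le_abs_self _
      _ = 2 * |r - q| := by rw [abs_mul, ha]; ring
  have h4 : -2 ≤ a := by rw [← ha]; exact neg_abs_le a
  have h5 : κ * θ * b ≤ κ * θ * B := by gcongr
  have h6 : 0 ≤ κ * y * b := by positivity
  have h7 := neg_abs_le r
  have h8 : 0 ≤ y * (K - (a ^ 2 / 2 + ρ * σ * a * b + σ ^ 2 * b ^ 2 / 2) + a / 2) := by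
    apply mul_nonneg hy.le
    rw [ha2]; linarith
  nlinarith

lemma hst_step (σ ρ κ θ q r : ℝ) (hρ₁ : -1 < ρ) (hρ₂ : ρ < 1)
    (hκ : 0 < κ) (hθ : 0 < θ)
    (O : Set (ℝ × ℝ)) (hO : IsOpen O) (hOsub : O ⊆ HH)
    (T : ℝ) (u : ℝ × (ℝ × ℝ) → ℝ)
    (hc : ContinuousOn u (parQ T O ∪ parB T O))
    (hd1 : ∀ p ∈ parQ T O, DifferentiableAt ℝ (fun s => u (s, p.2)) p.1)
    (hd2 : ∀ p ∈ parQ T O, DifferentiableAt ℝ (fun z => u (p.1, z)) p.2)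
    (hd3 : ∀ p ∈ parQ T O,
      DifferentiableAt ℝ (fun z => fderiv ℝ (fun z' => u (p.1, z')) z) p.2)
    (heq : ∀ p ∈ parQ T O, -Dt u p + hestonP σ ρ κ θ q r u p = 0)
    (hb : ∀ p ∈ parB T O, u p ≤ 0)
    (C M : ℝ) (hC : 0 < C) (hM : 0 ≤ M)
    (hg : ∀ p ∈ parQ T O, u p ≤ C * exp (M * p.2.2 + |p.2.1|))
    (K L : ℝ) (hK : 3 + 2 * |σ| * (M + 2) + σ ^ 2 * (M + 2) ^ 2 / 2 ≤ K)
    (hL : 2 * |r - q| + κ * θ * (M + 2) + |r| < L)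
    (s t1 : ℝ) (hs : 0 < s) (ht1 : t1 ≤ T) (hst : K * (t1 - s) ≤ 1)
    (hend : ∀ z ∈ O, u (t1, z) ≤ 0) :
    ∀ t ∈ Icc s t1, ∀ z ∈ O, u (t, z) ≤ 0 := by
  have hK0 : 0 < K := lt_of_lt_of_le (by positivity) hK
  have hL0 : 0 < L := lt_of_le_of_lt (by positivity) hL
  have hclO : closure O = O ∪ frontier O := closure_eq_self_union_frontier O
  -- the slab lies in the domain
  have hsub : Icc s t1 ×ˢ closure O ⊆ parQ T O ∪ parB T O := by
    rintro ⟨t, z⟩ ⟨ht, hz⟩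
    simp only at ht hz
    rcases eq_or_lt_of_le (ht.2.trans ht1) with h | h
    · right; right; exact ⟨h, hz⟩
    · rw [hclO] at hz
      rcases hz with hz | hz
      · left; exact ⟨⟨hs.trans_le ht.1, h⟩, hz⟩
      · right; left; exact ⟨⟨hs.trans_le ht.1, h⟩, hz⟩
  have hcly : ∀ z ∈ closure O, 0 ≤ z.2 := by
    intro z hz
    have : closure O ⊆ {z : ℝ × ℝ | 0 ≤ z.2} :=
      closure_minimal (fun z hz => le_of_lt (show 0 < z.2 from hOsub hz))
        (isClosed_le continuous_const continuous_snd)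
    exact this hz
  set Φ : ℝ × (ℝ × ℝ) → ℝ := fun p =>
    exp (2 * p.2.1 + (M + 1 + K * (t1 - p.1)) * p.2.2 + L * (t1 - p.1))
      + exp (-2 * p.2.1 + (M + 1 + K * (t1 - p.1)) * p.2.2 + L * (t1 - p.1)) with hΦ
  have hΦc : Continuous Φ := by rw [hΦ]; fun_prop
  have hΦpos : ∀ p, 0 < Φ p := fun p => by rw [hΦ]; positivity
  -- values on lateral and terminal boundary
  have hbd : ∀ t ∈ Icc s t1, ∀ z ∈ closure O, (t = t1 ∨ z ∉ O) → u (t, z) ≤ 0 := by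
    intro t ht z hz h
    by_cases hzO : z ∈ O
    · rcases h with h | h
      · rw [h]; exact hend z hzO
      · exact absurd hzO h
    · have hp := hsub (show (t, z) ∈ Icc s t1 ×ˢ closure O from ⟨ht, hz⟩)
      rcases hp with hp | hp
      · exact absurd hp.2 hzO
      · exact hb _ hp
  -- it suffices to bound by ε Φ
  suffices H : ∀ ε > 0, ∀ t ∈ Icc s t1, ∀ z ∈ closure O, u (t, z) ≤ ε * Φ (t, z) by
    intro t ht z hz
    by_contra hneg
    push Not at hneg
    have := H (u (t, z) / (2 * Φ (t, z))) (div_pos hneg (by linarith [hΦpos (t, z)])) t ht z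
      (subset_closure hz)
    have h2 : u (t, z) / (2 * Φ (t, z)) * Φ (t, z) = u (t, z) / 2 := by
      field_simp [(hΦpos (t, z)).ne']
    linarith
  intro ε hε
  -- bound at infinity
  obtain ⟨R, hR⟩ : ∃ R : ℝ, C ≤ ε * exp R := by
    refine ⟨Real.log (C / ε), ?_⟩
    rw [Real.exp_log (by positivity)]
    field_simp; exact le_refl _
  have hinf : ∀ t ∈ Icc s t1, ∀ z ∈ closure O, R < ‖z‖ → u (t, z) - ε * Φ (t, z) ≤ 0 := by
    intro t ht z hz hzR
    have hy := hcly z hz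
    by_cases hcase : t = t1 ∨ z ∉ O
    · have := hbd t ht z hz hcase
      have := mul_pos hε (hΦpos (t, z))
      linarith
    push Not at hcase
    have htlt : t < t1 := lt_of_le_of_ne ht.2 hcase.1
    have hg' := hg (t, z) ⟨⟨hs.trans_le ht.1, htlt.trans_le ht1⟩, hcase.2⟩
    simp only at hg'
    have hxy : R ≤ |z.1| + z.2 := by
      have : ‖z‖ ≤ |z.1| + z.2 := by
        rw [Prod.norm_def, Real.norm_eq_abs, Real.norm_eq_abs, abs_of_nonneg hy]
        exact max_le (by linarith) (by linarith [abs_nonneg z.1])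
      linarith
    have hΦl : exp (2 * |z.1| + (M + 1) * z.2) ≤ Φ (t, z) := by
      have k1 : 0 ≤ K * (t1 - t) * z.2 := by
        have : 0 ≤ t1 - t := by linarith
        positivity
      have k2 : 0 ≤ L * (t1 - t) := mul_nonneg hL0.le (by linarith)
      rcases abs_cases z.1 with ⟨h, _⟩ | ⟨h, _⟩
      · refine le_trans (exp_le_exp.2 ?_) (le_add_of_nonneg_right (exp_pos _).le)
        simp only; rw [h]; nlinarith
      · refine le_trans (exp_le_exp.2 ?_) (le_add_of_nonneg_left (exp_pos _).le)
        simp only; rw [h]; nlinarith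
    have : C * exp (M * z.2 + |z.1|) ≤ ε * exp (2 * |z.1| + (M + 1) * z.2) := by
      have e : exp (2 * |z.1| + (M + 1) * z.2) = exp (|z.1| + z.2) * exp (M * z.2 + |z.1|) := by
        rw [← exp_add]; congr 1; ring
      rw [e, ← mul_assoc]
      gcongr
      exact hR.trans (by gcongr)
    have := mul_le_mul_of_nonneg_left hΦl hε.le
    linarith
  by_contra hcon
  push Not at hcon
  obtain ⟨t0, ht0, z0, hz0, h0⟩ := hcon
  set G : ℝ × (ℝ × ℝ) → ℝ := fun p => exp (|r| * p.1) * (u p - ε * Φ p) with hG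
  set S : Set (ℝ × (ℝ × ℝ)) := Icc s t1 ×ˢ (closure O ∩ Metric.closedBall 0 R) with hS
  have hScomp : IsCompact S :=
    isCompact_Icc.prod ((isCompact_closedBall _ _).inter_left isClosed_closure)
  have hGc : ContinuousOn G S := by
    have huS : ContinuousOn u S := hc.mono fun p hp => hsub ⟨hp.1, hp.2.1⟩
    have : ContinuousOn (fun p : ℝ × (ℝ × ℝ) => exp (|r| * p.1)) S := by fun_prop
    exact this.mul (huS.sub (continuousOn_const.mul hΦc.continuousOn))
  have hp0 : (t0, z0) ∈ S := by
    refine ⟨ht0, hz0, ?_⟩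
    by_contra hnot
    simp only [Metric.mem_closedBall, dist_zero_right, not_le] at hnot
    have := hinf t0 ht0 z0 hz0 hnot
    linarith
  obtain ⟨⟨t, z⟩, hpS, hmax⟩ := hScomp.exists_isMaxOn ⟨_, hp0⟩ hGc
  have hGp : 0 < G (t, z) := by
    have h1 : G (t0, z0) ≤ G (t, z) := hmax hp0
    have h2 : 0 < G (t0, z0) := mul_pos (exp_pos _) (by linarith)
    linarith
  have hw : 0 < u (t, z) - ε * Φ (t, z) := (pos_iff_pos_of_mul_pos hGp).1 (exp_pos _)
  have hmax' : ∀ t' ∈ Icc s t1, ∀ z' ∈ closure O, G (t', z') ≤ G (t, z) := by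
    intro t' ht' z' hz'
    by_cases hin : z' ∈ Metric.closedBall (0 : ℝ × ℝ) R
    · exact hmax (show (t', z') ∈ S from ⟨ht', hz', hin⟩)
    · simp only [Metric.mem_closedBall, dist_zero_right, not_le] at hin
      have := hinf t' ht' z' hz' hin
      have h3 : G (t', z') ≤ 0 := mul_nonpos_of_nonneg_of_nonpos (exp_pos _).le this
      linarith
  have ht : t ∈ Icc s t1 := hpS.1
  have hz : z ∈ closure O := hpS.2.1
  have hint : t ≠ t1 ∧ z ∈ O := by
    by_contra hnot
    have : t = t1 ∨ z ∉ O := by tauto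
    have := hbd t ht z hz this
    have := mul_pos hε (hΦpos (t, z))
    linarith
  obtain ⟨htne, hzO⟩ := hint
  have htlt : t < t1 := lt_of_le_of_ne ht.2 htne
  have htT : t ∈ Ioo 0 T := ⟨hs.trans_le ht.1, htlt.trans_le ht1⟩
  have hpQ : (t, z) ∈ parQ T O := ⟨htT, hzO⟩
  have hy : 0 < z.2 := hOsub hzO
  set b := M + 1 + K * (t1 - t) with hbdef
  set c := L * (t1 - t) with hcdef
  set E1 := exp (2 * z.1 + b * z.2 + c) with hE1
  set E2 := exp (-2 * z.1 + b * z.2 + c) with hE2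
  have hΦtz : Φ (t, z) = E1 + E2 := rfl
  -- time derivative
  have hdt : |r| * (u (t, z) - ε * Φ (t, z)) + Dt u (t, z)
      + ε * ((K * z.2 + L) * (E1 + E2)) ≤ 0 := by
    have e1 : HasDerivAt (fun τ : ℝ => exp (|r| * τ)) (exp (|r| * t) * |r|) t := by
      simpa using ((hasDerivAt_id t).const_mul |r|).exp
    have e2 : HasDerivAt (fun τ => u (τ, z)) (Dt u (t, z)) t := (hd1 _ hpQ).hasDerivAt
    have e3 : ∀ a : ℝ, HasDerivAt
        (fun τ : ℝ => exp (a * z.1 + (M + 1 + K * (t1 - τ)) * z.2 + L * (t1 - τ)))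
        (exp (a * z.1 + b * z.2 + c) * (-(K * z.2 + L))) t := by
      intro a
      have i0 : HasDerivAt (fun τ : ℝ => t1 - τ) (-1) t := by
        simpa using (hasDerivAt_id t).const_sub t1
      have i1 : HasDerivAt
          (fun τ : ℝ => a * z.1 + (M + 1 + K * (t1 - τ)) * z.2 + L * (t1 - τ))
          ((K * -1) * z.2 + L * -1) t :=
        ((((i0.const_mul K).const_add (M + 1)).mul_const z.2).const_add (a * z.1)).add
          (i0.const_mul L)
      convert i1.exp using 1
      rw [hbdef, hcdef]; ring
    have e4 := e1.mul (e2.sub (((e3 2).add (e3 (-2))).const_mul ε))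
    have := hst_time_test _ _ t t1 htlt e4 (by
      intro τ hτ
      exact hmax' τ ⟨ht.1.trans hτ.1, hτ.2⟩ z hz)
    have h5 : exp (|r| * t) * (|r| * (u (t, z) - ε * Φ (t, z)) + Dt u (t, z)
      + ε * ((K * z.2 + L) * (E1 + E2))) ≤ 0 := by
      refine le_trans (le_of_eq ?_) this
      simp only [hΦtz, Pi.add_apply, Pi.sub_apply]
      rw [hE1, hE2]
      ring
    exact nonpos_of_mul_nonpos_right h5 (exp_pos _)
  -- spatial maximum
  have hA := hst_A_at_max σ ρ κ θ q r hρ₁ hρ₂ (fun z => u (t, z)) O hO z hzO hy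
    (fun z' hz' => hd2 (t, z') ⟨htT, hz'⟩) (hd3 (t, z) hpQ) ε 2 b c (by
      intro z' hz'
      have := hmax' t ht z' (subset_closure hz')
      exact le_of_mul_le_mul_left this (exp_pos _))
  have heq' := heq (t, z) hpQ
  have hA' : hestonP σ ρ κ θ q r u (t, z) = hestonA σ ρ κ θ q r (fun z => u (t, z)) z := rfl
  rw [hA'] at heq'
  have hKt0 : 0 ≤ K * (t1 - t) := mul_nonneg hK0.le (by linarith)
  have hKt1 : K * (t1 - t) ≤ 1 := le_trans (by gcongr; exact ht.1) hst
  have hb0 : 0 ≤ b := by rw [hbdef]; linarith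
  have hb1 : b ≤ M + 2 := by rw [hbdef]; linarith
  have B1 := hst_bracket σ ρ κ θ q r K L (M + 2) 2 b z.2 hρ₁ hρ₂ hκ hθ (by linarith) hK hL
    (by norm_num) hb0 hb1 hy
  have B2 := hst_bracket σ ρ κ θ q r K L (M + 2) (-2) b z.2 hρ₁ hρ₂ hκ hθ (by linarith) hK hL
    (by norm_num) hb0 hb1 hy
  have P1 := mul_pos (mul_pos hε (show 0 < E1 from exp_pos _)) B1
  have P2 := mul_pos (mul_pos hε (show 0 < E2 from exp_pos _)) B2
  have hr0 : 0 ≤ (|r| + r) * (u (t, z) - ε * Φ (t, z)) :=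
    mul_nonneg (by linarith [neg_abs_le r]) hw.le
  rw [hΦtz] at hr0 hdt
  change ε * (E1 * _ + E2 * _) + _ ≤ _ at hA
  linarith

lemma hst_nonpos (σ ρ κ θ q r : ℝ) (hρ₁ : -1 < ρ) (hρ₂ : ρ < 1)
    (hκ : 0 < κ) (hθ : 0 < θ)
    (O : Set (ℝ × ℝ)) (hO : IsOpen O) (hOsub : O ⊆ HH)
    (T : ℝ) (u : ℝ × (ℝ × ℝ) → ℝ)
    (hc : ContinuousOn u (parQ T O ∪ parB T O))
    (hd1 : ∀ p ∈ parQ T O, DifferentiableAt ℝ (fun s => u (s, p.2)) p.1)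
    (hd2 : ∀ p ∈ parQ T O, DifferentiableAt ℝ (fun z => u (p.1, z)) p.2)
    (hd3 : ∀ p ∈ parQ T O,
      DifferentiableAt ℝ (fun z => fderiv ℝ (fun z' => u (p.1, z')) z) p.2)
    (heq : ∀ p ∈ parQ T O, -Dt u p + hestonP σ ρ κ θ q r u p = 0)
    (hb : ∀ p ∈ parB T O, u p ≤ 0)
    (C M : ℝ) (hC : 0 < C) (hM : 0 ≤ M)
    (hg : ∀ p ∈ parQ T O, u p ≤ C * exp (M * p.2.2 + |p.2.1|)) :
    ∀ p ∈ parQ T O, u p ≤ 0 := by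
  set K := 3 + 2 * |σ| * (M + 2) + σ ^ 2 * (M + 2) ^ 2 / 2 with hK
  set L := 2 * |r - q| + κ * θ * (M + 2) + |r| + 1 with hL
  have hK0 : 0 < K := by rw [hK]; positivity
  have main : ∀ n : ℕ, ∀ t, 0 < t → t ≤ T → T - n / K ≤ t → ∀ z ∈ O, u (t, z) ≤ 0 := by
    intro n
    induction n with
    | zero =>
      intro t h0 h1 h2 z hz
      have : t = T := le_antisymm h1 (by simpa using h2)
      exact hb _ (Or.inr ⟨this, subset_closure hz⟩)
    | succ n ih =>
      intro t h0 h1 h2 z hz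
      by_cases h : T - n / K ≤ t
      · exact ih t h0 h1 h z hz
      push Not at h
      have hn : (0:ℝ) ≤ n / K := by positivity
      refine hst_step σ ρ κ θ q r hρ₁ hρ₂ hκ hθ O hO hOsub T u hc hd1 hd2 hd3 heq hb C M hC hM hg
        K L le_rfl (by rw [hL]; linarith) t (T - n / K) h0 (by linarith) ?_
        (ih (T - n / K) (by linarith) (by linarith) le_rfl) t ⟨le_rfl, h.le⟩ z hz
      have h3 : T - n / K - t ≤ 1 / K := by
        push_cast at h2
        rw [add_div] at h2
        linarith
      calc K * (T - n / K - t) ≤ K * (1 / K) := by gcongr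
        _ = 1 := by field_simp
  rintro ⟨t, z⟩ ⟨ht, hz⟩
  obtain ⟨n, hn⟩ := exists_nat_ge (K * T)
  refine main n t ht.1 ht.2.le ?_ z hz
  have : T ≤ n / K := by rw [le_div_iff₀ hK0]; linarith
  linarith [ht.1]

lemma hst_growth (σ κ : ℝ) (S : Set (ℝ × (ℝ × ℝ))) (hS : ∀ p ∈ S, 0 ≤ p.2.2)
    (v : ℝ × (ℝ × ℝ) → ℝ) (h : parabGrowth σ κ S v) :
    ∃ C M : ℝ, 0 < C ∧ 0 ≤ M ∧ ∀ p ∈ S, |v p| ≤ C * exp (M * p.2.2 + |p.2.1|) := by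
  obtain ⟨C, M₁, M₂, hC, h1, -, h2, h3, h4⟩ := h
  refine ⟨3 * C, M₁, by positivity, h1, fun p hp => (h4 p hp).trans ?_⟩
  have hy := hS p hp
  have k0 := mul_nonneg h1 hy
  have a0 := abs_nonneg p.2.1
  have e1 : 1 ≤ exp (M₁ * p.2.2 + |p.2.1|) := one_le_exp (by positivity)
  have e2 : exp (M₁ * p.2.2) ≤ exp (M₁ * p.2.2 + |p.2.1|) := exp_le_exp.2 (by linarith)
  have e3 : exp (M₂ * p.2.1) ≤ exp (M₁ * p.2.2 + |p.2.1|) := by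
    apply exp_le_exp.2
    have : M₂ * p.2.1 ≤ |p.2.1| := by
      calc M₂ * p.2.1 ≤ M₂ * |p.2.1| := by gcongr; exact le_abs_self _
        _ ≤ 1 * |p.2.1| := by gcongr
        _ = _ := one_mul _
    linarith
  nlinarith

lemma hst_le (σ ρ κ θ q r : ℝ) (hρ₁ : -1 < ρ) (hρ₂ : ρ < 1)
    (hκ : 0 < κ) (hθ : 0 < θ)
    (O : Set (ℝ × ℝ)) (hO : IsOpen O) (hOsub : O ⊆ HH)
    (T : ℝ) (f g u₁ u₂ : ℝ × (ℝ × ℝ) → ℝ)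
    (hu₁c : ContinuousOn u₁ (parQ T O ∪ parB T O)) (hu₁d : C2Parab (parQ T O) u₁)
    (hu₁g : parabGrowth σ κ (parQ T O) u₁)
    (hu₁eq : ∀ p ∈ parQ T O, -Dt u₁ p + hestonP σ ρ κ θ q r u₁ p = f p)
    (hu₁b : ∀ p ∈ parB T O, u₁ p = g p)
    (hu₂c : ContinuousOn u₂ (parQ T O ∪ parB T O)) (hu₂d : C2Parab (parQ T O) u₂)
    (hu₂g : parabGrowth σ κ (parQ T O) u₂)
    (hu₂eq : ∀ p ∈ parQ T O, -Dt u₂ p + hestonP σ ρ κ θ q r u₂ p = f p)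
    (hu₂b : ∀ p ∈ parB T O, u₂ p = g p) :
    ∀ p ∈ parQ T O, u₁ p ≤ u₂ p := by
  have hy : ∀ p ∈ parQ T O, 0 ≤ p.2.2 := fun p hp => le_of_lt (hOsub hp.2)
  obtain ⟨C₁, M₁, hC₁, hM₁, hg₁⟩ := hst_growth σ κ _ hy u₁ hu₁g
  obtain ⟨C₂, M₂, hC₂, hM₂, hg₂⟩ := hst_growth σ κ _ hy u₂ hu₂g
  obtain ⟨a1, -, b1, -, c1, -⟩ := hu₁d
  obtain ⟨a2, -, b2, -, c2, -⟩ := hu₂d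
  have hfd : ∀ p ∈ parQ T O, ∀ᶠ z in nhds p.2,
      fderiv ℝ (fun z' => u₁ (p.1, z') - u₂ (p.1, z')) z
        = fderiv ℝ (fun z' => u₁ (p.1, z')) z - fderiv ℝ (fun z' => u₂ (p.1, z')) z := by
    intro p hp
    filter_upwards [hO.mem_nhds hp.2] with z hz
    exact fderiv_fun_sub (b1 (p.1, z) ⟨hp.1, hz⟩) (b2 (p.1, z) ⟨hp.1, hz⟩)
  have hc3 : ∀ p ∈ parQ T O, DifferentiableAt ℝ
      (fun z => fderiv ℝ (fun z' => u₁ (p.1, z') - u₂ (p.1, z')) z) p.2 := by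
    intro p hp
    exact ((c1 p hp).sub (c2 p hp)).congr_of_eventuallyEq (hfd p hp)
  have key := hst_nonpos σ ρ κ θ q r hρ₁ hρ₂ hκ hθ O hO hOsub T (fun p => u₁ p - u₂ p)
    (hu₁c.sub hu₂c)
    (fun p hp => (a1 p hp).sub (a2 p hp))
    (fun p hp => (b1 p hp).sub (b2 p hp))
    hc3
    (by
      intro p hp
      have e1 := hu₁eq p hp
      have e2 := hu₂eq p hp
      have hDt : Dt (fun p => u₁ p - u₂ p) p = Dt u₁ p - Dt u₂ p :=
        deriv_fun_sub (a1 p hp) (a2 p hp)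
      have hD1 : ∀ v, D1 (fun z => u₁ (p.1, z) - u₂ (p.1, z)) p.2 v
          = D1 (fun z => u₁ (p.1, z)) p.2 v - D1 (fun z => u₂ (p.1, z)) p.2 v := by
        intro v
        unfold D1
        rw [(hfd p hp).self_of_nhds]; rfl
      have hD2 : ∀ v w, D2 (fun z => u₁ (p.1, z) - u₂ (p.1, z)) p.2 v w
          = D2 (fun z => u₁ (p.1, z)) p.2 v w - D2 (fun z => u₂ (p.1, z)) p.2 v w := by
        intro v w
        rw [hst_D2_eq _ _ (hc3 p hp), hst_D2_eq _ _ (c1 p hp), hst_D2_eq _ _ (c2 p hp)]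
        rw [Filter.EventuallyEq.fderiv_eq (hfd p hp), fderiv_fun_sub (c1 p hp) (c2 p hp)]
        rfl
      unfold hestonP hestonA at e1 e2 ⊢
      rw [hDt]
      simp only [hD1, hD2]
      linarith)
    (by
      intro p hp
      simp only [hu₁b p hp, hu₂b p hp, sub_self, le_refl])
    (C₁ + C₂) (max M₁ M₂) (by positivity) (le_max_of_le_left hM₁)
    (by
      intro p hp
      have k1 := (le_abs_self _).trans (hg₁ p hp)
      have k2 := (neg_le_abs _).trans (hg₂ p hp)
      have hyp := hy p hp
      have l1 : exp (M₁ * p.2.2 + |p.2.1|) ≤ exp (max M₁ M₂ * p.2.2 + |p.2.1|) := by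
        gcongr; exact le_max_left _ _
      have l2 : exp (M₂ * p.2.2 + |p.2.1|) ≤ exp (max M₁ M₂ * p.2.2 + |p.2.1|) := by
        gcongr; exact le_max_right _ _
      nlinarith)
  intro p hp
  have := key p hp
  linarith

/-- Uniqueness of solutions to the parabolic Heston terminal/boundary value problem with
full Dirichlet boundary condition, when `0 < β < 1`. -/
theorem heston_parabolic_bvp_uniqueness_beta_lt_one
    (σ ρ κ θ q r : ℝ) (hσ : σ ≠ 0) (hρ₁ : -1 < ρ) (hρ₂ : ρ < 1)
    (hκ : 0 < κ) (hθ : 0 < θ)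
    (hβ₀ : 0 < 2 * κ * θ / σ ^ 2) (hβ₁ : 2 * κ * θ / σ ^ 2 < 1)
    (O : Set (ℝ × ℝ)) (hO : IsOpen O) (hOconn : IsConnected O) (hOsub : O ⊆ HH)
    (hΓ₀ : (Gamma0 O).Nonempty)
    (T : ℝ) (hT : 0 < T)
    (f g u₁ u₂ : ℝ × (ℝ × ℝ) → ℝ)
    (hf : ContinuousOn f (parQ T O)) (hfg : parabGrowth σ κ (parQ T O) f)
    (hg : ContinuousOn g (parB T O)) (hgg : parabGrowth σ κ (parB T O) g)
    (hu₁c : ContinuousOn u₁ (parQ T O ∪ parB T O)) (hu₁d : C2Parab (parQ T O) u₁)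
    (hu₁g : parabGrowth σ κ (parQ T O) u₁)
    (hu₁eq : ∀ p ∈ parQ T O, -Dt u₁ p + hestonP σ ρ κ θ q r u₁ p = f p)
    (hu₁b : ∀ p ∈ parB T O, u₁ p = g p)
    (hu₂c : ContinuousOn u₂ (parQ T O ∪ parB T O)) (hu₂d : C2Parab (parQ T O) u₂)
    (hu₂g : parabGrowth σ κ (parQ T O) u₂)
    (hu₂eq : ∀ p ∈ parQ T O, -Dt u₂ p + hestonP σ ρ κ θ q r u₂ p = f p)
    (hu₂b : ∀ p ∈ parB T O, u₂ p = g p) :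
    EqOn u₁ u₂ (parQ T O ∪ parB T O) := by
  rintro p (hp | hp)
  · exact le_antisymm
      (hst_le σ ρ κ θ q r hρ₁ hρ₂ hκ hθ O hO hOsub T f g u₁ u₂ hu₁c hu₁d hu₁g hu₁eq hu₁b
        hu₂c hu₂d hu₂g hu₂eq hu₂b p hp)
      (hst_le σ ρ κ θ q r hρ₁ hρ₂ hκ hθ O hO hOsub T f g u₂ u₁ hu₂c hu₂d hu₂g hu₂eq hu₂b
        hu₁c hu₁d hu₁g hu₁eq hu₁b p hp)
  · rw [hu₁b p hp, hu₂b p hp]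

end
end
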